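/- arXiv:1906.03730 — 9 statements merged into one kernel-verified Lean document; each statement's English description precedes it below -/
import Mathlib

section
/- For every natural number n and every subgroup H of the symmetric group S_n, the group F(S_n, H) = (H ∩ [S_n, S_n]) / Φ^{S_n}(H) is an elementary abelian 2-group; equivalently, for every h ∈ H with h ∈ [S_n, S_n], the square h² lies in the focal subgroup Φ^{S_n}(H). -/
/-- The set of generators of the focal subgroup of `H` in `G`. -/
def focalSet {G : Type*} [Group G] (H : Subgroup G) : Set G :=
  {x : G | ∃ h ∈ H, ∃ g : G, g⁻¹ * h * g ∈ H ∧ x = h⁻¹ * (g⁻¹ * h * g)}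

/-- The focal subgroup `Φ^G(H)` of a subgroup `H` of `G`. -/
def focal {G : Type*} [Group G] (H : Subgroup G) : Subgroup G :=
  Subgroup.closure (focalSet H)

theorem focal_conj_mem {G : Type*} [Group G] (H : Subgroup G) {c x : G}
    (hc : c ∈ H) (hx : x ∈ focal H) : c⁻¹ * x * c ∈ focal H := by
  have hx' : x ∈ Subgroup.closure (focalSet H) := hx
  clear hx
  induction hx' using Subgroup.closure_induction with
  | mem s hs =>
      obtain ⟨a, ha, g, hg, rfl⟩ := hs
      apply Subgroup.subset_closure
      refine ⟨c⁻¹ * a * c, H.mul_mem (H.mul_mem (H.inv_mem hc) ha) hc,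
        c⁻¹ * g * c, ?_, ?_⟩
      · have h1 : (c⁻¹ * g * c)⁻¹ * (c⁻¹ * a * c) * (c⁻¹ * g * c)
            = c⁻¹ * (g⁻¹ * a * g) * c := by group
        rw [h1]
        exact H.mul_mem (H.mul_mem (H.inv_mem hc) hg) hc
      · group
  | one => simpa using (focal H).one_mem
  | mul x y hxm hym ihx ihy =>
      have h2 : c⁻¹ * (x * y) * c = (c⁻¹ * x * c) * (c⁻¹ * y * c) := by group
      rw [h2]; exact (focal H).mul_mem ihx ihy
  | inv x hxm ih =>
      have h3 : c⁻¹ * x⁻¹ * c = (c⁻¹ * x * c)⁻¹ := by group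
      rw [h3]; exact (focal H).inv_mem ih

instance focal_subgroupOf_normal {G : Type*} [Group G] (H : Subgroup G) :
    ((focal H).subgroupOf (H ⊓ commutator G)).Normal := by
  constructor
  intro x hx k
  rw [Subgroup.mem_subgroupOf] at hx ⊢
  have hk : (k : G) ∈ H := (Subgroup.mem_inf.mp k.2).1
  have h := focal_conj_mem H (H.inv_mem hk) hx
  rw [inv_inv] at h
  simpa using h

/-- `F(G,H) = (H ∩ [G,G]) / Φ^G(H)`. -/
abbrev FGroup {G : Type*} [Group G] (H : Subgroup G) :=
  ↥(H ⊓ commutator G) ⧸ ((focal H).subgroupOf (H ⊓ commutator G))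

theorem sq_mem_focal_of_isConj_inv {G : Type*} [Group G] (H : Subgroup G) {h : G}
    (hh : h ∈ H) (hconj : IsConj h h⁻¹) : h ^ 2 ∈ focal H := by
  obtain ⟨c, hc⟩ := isConj_iff.mp hconj
  rw [← inv_mem_iff]
  refine Subgroup.subset_closure ⟨h, hh, c⁻¹, ?_, ?_⟩
  · rw [inv_inv, hc]
    exact H.inv_mem hh
  · rw [inv_inv, hc, sq, mul_inv_rev]

theorem Equiv.Perm.isConj_inv_self {α : Type*} [Fintype α] [DecidableEq α]
    (σ : Equiv.Perm α) : IsConj σ σ⁻¹ :=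
  Equiv.Perm.isConj_iff_cycleType_eq.mpr σ.cycleType_inv.symm

/-- For every `n` and every subgroup `H ≤ Sₙ`, the group
`F(Sₙ, H) = (H ∩ [Sₙ, Sₙ]) / Φ^{Sₙ}(H)` is an elementary abelian 2-group; equivalently,
for every `h ∈ H` lying in `[Sₙ, Sₙ]`, the square `h ^ 2` lies in the focal subgroup. -/
theorem elementary_abelian_two_of_symmetric (n : ℕ) (H : Subgroup (Equiv.Perm (Fin n))) :
    (∀ x : FGroup H, x ^ 2 = 1) ∧
    (∀ h : Equiv.Perm (Fin n), h ∈ H → h ∈ commutator (Equiv.Perm (Fin n)) →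
      h ^ 2 ∈ focal H) := by
  have sq_mem : ∀ h ∈ H, h ^ 2 ∈ focal H := fun h hh =>
    sq_mem_focal_of_isConj_inv H hh h.isConj_inv_self
  refine ⟨fun x => ?_, fun h hh _ => sq_mem h hh⟩
  obtain ⟨y, rfl⟩ := QuotientGroup.mk_surjective x
  rw [← QuotientGroup.mk_pow, QuotientGroup.eq_one_iff, Subgroup.mem_subgroupOf]
  exact sq_mem y y.2.1
end

section
/- For every natural number n and every subgroup H of the alternating group A_n, the group F(A_n, H) = (H ∩ [A_n, A_n]) / Φ^{A_n}(H) is either trivial, or cyclic of order 3, or an elementary abelian 2-group (i.e., either every element of F(A_n,H) has order dividing 2, or F(A_n,H) is isomorphic to ℤ/3ℤ). -/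
set_option synthInstance.maxHeartbeats 1000000
set_option maxHeartbeats 1000000

theorem Multiset.exists_finset_map_pow_of_nodup {s : Multiset ℕ} (p : ℕ) (hs : s.Nodup)
    (hp : ∀ a ∈ s, ∃ k, a = p ^ k) : ∃ t : Finset ℕ, s = t.val.map (p ^ ·) := by
  choose! f hf using hp
  have hmap : (s.map f).map (p ^ ·) = s := by
    rw [Multiset.map_map]
    conv_rhs => rw [← Multiset.map_id s]
    exact Multiset.map_congr rfl fun a ha => (hf a ha).symm
  refine ⟨⟨s.map f, ?_⟩, hmap.symm⟩
  apply Multiset.Nodup.of_map (p ^ ·)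
  rwa [hmap]

/-- A multiset of distinct powers of `p ≥ 2` is determined by its sum. -/
theorem Multiset.eq_of_sum_eq_of_nodup_of_pow {s t : Multiset ℕ} {p : ℕ} (hp : 2 ≤ p)
    (hs : s.Nodup) (ht : t.Nodup) (hsp : ∀ a ∈ s, ∃ k, a = p ^ k)
    (htp : ∀ a ∈ t, ∃ k, a = p ^ k) (h : s.sum = t.sum) : s = t := by
  obtain ⟨u, rfl⟩ := Multiset.exists_finset_map_pow_of_nodup p hs hsp
  obtain ⟨v, rfl⟩ := Multiset.exists_finset_map_pow_of_nodup p ht htp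
  rw [Finset.geomSum_injective hp h]

namespace Equiv.Perm

variable {α : Type*} [Fintype α] [DecidableEq α]

theorem cycleType_pow_of_coprime (σ : Perm α) {k : ℕ} (hk : k.Coprime (orderOf σ)) :
    (σ ^ k).cycleType = σ.cycleType := by
  induction σ using cycle_induction_on with
  | base_one => simp
  | base_cycles σ hσ =>
    rw [(hσ.pow_iff.2 hk).cycleType, hσ.cycleType, support_pow_coprime hk]
  | induction_disjoint σ τ hd _ hσ hτ =>
    rw [hd.orderOf] at hk
    rw [hd.commute.mul_pow, (hd.pow_disjoint_pow k k).cycleType_mul, hd.cycleType_mul,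
      hσ (hk.coprime_dvd_right (Nat.dvd_lcm_left _ _)),
      hτ (hk.coprime_dvd_right (Nat.dvd_lcm_right _ _))]

theorem exists_inv_mul_mul_eq_of_cycleType_eq {σ τ : Perm α} (h : σ.cycleType = τ.cycleType) :
    ∃ g : Perm α, g⁻¹ * σ * g = τ := by
  obtain ⟨c, hc⟩ := isConj_iff.1 (isConj_of_cycleType_eq h)
  exact ⟨c⁻¹, by rw [inv_inv, hc]⟩

theorem odd_orderOf_of_centralizer_le_alternatingGroup {σ : Perm α}
    (h : Subgroup.centralizer {σ} ≤ alternatingGroup α) : Odd (orderOf σ) := by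
  rw [← Nat.not_even_iff_odd, even_iff_two_dvd]
  intro h2
  obtain ⟨i, hi, hdvd⟩ : ∃ i ∈ σ.cycleType, 2 ∣ i := by
    by_contra! hne
    have hdvd : σ.cycleType.lcm ∣ σ.cycleType.prod :=
      Multiset.lcm_dvd.2 fun _ => Multiset.dvd_prod
    rw [lcm_cycleType] at hdvd
    obtain ⟨i, hi, hi2⟩ := Nat.prime_two.prime.exists_mem_multiset_dvd (h2.trans hdvd)
    exact hne i hi hi2
  exact Nat.not_even_iff_odd.2
    (OnCycleFactors.odd_of_centralizer_le_alternatingGroup h i hi) (even_iff_two_dvd.2 hdvd)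

/-- Elements of `p`-power order whose centralizer is contained in the alternating group
all have the same cycle type. -/
theorem cycleType_eq_of_centralizer_le_alternatingGroup {σ τ : Perm α} {p a b : ℕ}
    (hp : p.Prime) (hσ : orderOf σ ∣ p ^ a) (hτ : orderOf τ ∣ p ^ b)
    (hσc : Subgroup.centralizer {σ} ≤ alternatingGroup α)
    (hτc : Subgroup.centralizer {τ} ≤ alternatingGroup α) :
    σ.cycleType = τ.cycleType := by
  have nodup {ρ : Perm α} (h : Subgroup.centralizer {ρ} ≤ alternatingGroup α) :
      ρ.partition.parts.Nodup := by
    obtain ⟨-, hcard, hcount⟩ := centralizer_le_alternating_iff.1 h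
    rw [parts_partition, Multiset.nodup_add]
    refine ⟨Multiset.nodup_iff_count_le_one.2 hcount, ?_, ?_⟩
    · rw [Multiset.nodup_iff_count_le_one]
      intro i
      rw [Multiset.count_replicate]
      rw [sum_cycleType] at hcard
      split_ifs <;> omega
    · rw [Multiset.disjoint_left]
      intro i hi h1
      exact (one_lt_of_mem_cycleType hi).ne' (Multiset.eq_of_mem_replicate h1)
  have pow {ρ : Perm α} {c : ℕ} (h : orderOf ρ ∣ p ^ c) :
      ∀ i ∈ ρ.partition.parts, ∃ k, i = p ^ k := by
    intro i hi
    rw [parts_partition, Multiset.mem_add] at hi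
    rcases hi with hi | hi
    · obtain ⟨k, -, hk⟩ := (Nat.dvd_prime_pow hp).1 ((dvd_of_mem_cycleType hi).trans h)
      exact ⟨k, hk⟩
    · exact ⟨0, by rw [Multiset.eq_of_mem_replicate hi, pow_zero]⟩
  rw [← isConj_iff_cycleType_eq, partition_eq_of_isConj]
  ext1
  exact Multiset.eq_of_sum_eq_of_nodup_of_pow hp.two_le (nodup hσc) (nodup hτc) (pow hσ) (pow hτ)
    (σ.partition.parts_sum.trans τ.partition.parts_sum.symm)

end Equiv.Perm

namespace alternatingGroup

open Equiv.Perm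

variable {α : Type*} [Fintype α] [DecidableEq α]

theorem exists_inv_mul_mul_eq_of_sign_eq_one {x y : alternatingGroup α} {g : Equiv.Perm α}
    (hg : sign g = 1) (h : g⁻¹ * x * g = y) : ∃ g : alternatingGroup α, g⁻¹ * x * g = y :=
  ⟨⟨g, mem_alternatingGroup.2 hg⟩, Subtype.ext h⟩

theorem centralizer_le_of_not_exists_inv_mul_mul_eq_inv {x : alternatingGroup α}
    (h : ¬ ∃ g : alternatingGroup α, g⁻¹ * x * g = x⁻¹) :
    Subgroup.centralizer {(x : Equiv.Perm α)} ≤ alternatingGroup α := by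
  intro c hc
  by_contra hodd
  rw [Subgroup.mem_centralizer_singleton_iff] at hc
  rw [mem_alternatingGroup, ← ne_eq, Int.units_ne_iff_eq_neg] at hodd
  obtain ⟨g, hg⟩ := exists_inv_mul_mul_eq_of_cycleType_eq (cycleType_inv (x : Equiv.Perm α)).symm
  rcases Int.units_eq_one_or (sign g) with hs | hs
  · exact h (exists_inv_mul_mul_eq_of_sign_eq_one hs hg)
  · refine h (exists_inv_mul_mul_eq_of_sign_eq_one (g := c * g) (by simp [hs, hodd]) ?_)
    have hc' : c⁻¹ * (x : Equiv.Perm α) * c = x := by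
      rw [mul_assoc, ← hc, inv_mul_cancel_left]
    calc (c * g)⁻¹ * (x : Equiv.Perm α) * (c * g) = g⁻¹ * (c⁻¹ * x * c) * g := by group
      _ = _ := by rw [hc', hg]; rfl

theorem exists_inv_mul_mul_eq_inv_or_pow_four (x : alternatingGroup α) :
    (∃ g : alternatingGroup α, g⁻¹ * x * g = x⁻¹) ∨
      ∃ g : alternatingGroup α, g⁻¹ * x * g = x ^ 4 := by
  refine or_iff_not_imp_left.2 fun h => ?_
  have hodd := odd_orderOf_of_centralizer_le_alternatingGroup
    (centralizer_le_of_not_exists_inv_mul_mul_eq_inv h)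
  obtain ⟨g, hg⟩ := exists_inv_mul_mul_eq_of_cycleType_eq
    (cycleType_pow_of_coprime (x : Equiv.Perm α) (Nat.coprime_two_left.2 hodd)).symm
  refine exists_inv_mul_mul_eq_of_sign_eq_one (g := g * g) (by simp) ?_
  calc (g * g)⁻¹ * (x : Equiv.Perm α) * (g * g) = g⁻¹ * (g⁻¹ * x * g) * g := by group
    _ = g⁻¹ * (x ^ 2 : Equiv.Perm α) * g := by rw [hg]
    _ = (g⁻¹ * x * g) * (g⁻¹ * x * g) := by rw [pow_two]; group
    _ = _ := by rw [hg, ← pow_add]; rfl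

/-- Two elements of `p`-power order which are not conjugate to their inverses in the alternating
group are conjugate up to inversion. -/
theorem exists_inv_mul_mul_eq_or_eq_inv {x y : alternatingGroup α} {p a b : ℕ} (hp : p.Prime)
    (hx : orderOf x ∣ p ^ a) (hy : orderOf y ∣ p ^ b)
    (hxi : ¬ ∃ g : alternatingGroup α, g⁻¹ * x * g = x⁻¹)
    (hyi : ¬ ∃ g : alternatingGroup α, g⁻¹ * y * g = y⁻¹) :
    (∃ g : alternatingGroup α, g⁻¹ * x * g = y) ∨
      ∃ g : alternatingGroup α, g⁻¹ * x * g = y⁻¹ := by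
  rw [← Subgroup.orderOf_coe] at hx hy
  obtain ⟨g, hg⟩ := exists_inv_mul_mul_eq_of_cycleType_eq
    (cycleType_eq_of_centralizer_le_alternatingGroup hp hx hy
      (centralizer_le_of_not_exists_inv_mul_mul_eq_inv hxi)
      (centralizer_le_of_not_exists_inv_mul_mul_eq_inv hyi))
  obtain ⟨k, hk⟩ := exists_inv_mul_mul_eq_of_cycleType_eq (cycleType_inv (y : Equiv.Perm α)).symm
  have hk' : sign k = -1 := by
    rw [← Int.units_ne_iff_eq_neg]
    exact fun hs => hyi (exists_inv_mul_mul_eq_of_sign_eq_one hs hk)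
  rcases Int.units_eq_one_or (sign g) with hs | hs
  · exact .inl (exists_inv_mul_mul_eq_of_sign_eq_one hs hg)
  · refine .inr (exists_inv_mul_mul_eq_of_sign_eq_one (g := g * k) (by simp [hs, hk']) ?_)
    calc (g * k)⁻¹ * (x : Equiv.Perm α) * (g * k) = k⁻¹ * (g⁻¹ * x * g) * k := by group
      _ = _ := by rw [hg, hk]; rfl

end alternatingGroup

theorem FGroup.mk_eq_mk_of_conj {G : Type*} [Group G] {H : Subgroup G}
    {x y : ↥(H ⊓ commutator G)} (h : ∃ g : G, g⁻¹ * x * g = y) :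
    (x : FGroup H) = (y : FGroup H) := by
  obtain ⟨g, hg⟩ := h
  rw [QuotientGroup.eq, Subgroup.mem_subgroupOf]
  apply Subgroup.subset_closure
  refine ⟨x, (Subgroup.mem_inf.1 x.2).1, g, ?_, ?_⟩
  · rw [hg]
    exact (Subgroup.mem_inf.1 y.2).1
  · rw [hg]
    rfl

theorem FGroup.mul_comm {G : Type*} [Group G] {H : Subgroup G} (a b : FGroup H) :
    a * b = b * a := by
  induction a using QuotientGroup.induction_on with | H x
  induction b using QuotientGroup.induction_on with | H y
  exact FGroup.mk_eq_mk_of_conj (x := x * y) (y := y * x) ⟨x, by push_cast; group⟩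

/-- Every element of exponent `3` of a quotient of a finite group lifts to an element of
`3`-power order. -/
theorem QuotientGroup.exists_mk_eq_of_pow_three_eq_one {G : Type*} [Group G] [Finite G]
    {N : Subgroup G} [N.Normal] {a : G ⧸ N} (ha : a ^ 3 = 1) :
    ∃ (y : G) (k : ℕ), orderOf y ∣ 3 ^ k ∧ (y : G ⧸ N) = a := by
  obtain ⟨x, rfl⟩ := QuotientGroup.mk_surjective a
  obtain ⟨k, m, hm, hkm⟩ :=
    Nat.exists_eq_pow_mul_and_not_dvd (orderOf_pos x).ne' 3 (by norm_num)
  refine ⟨x ^ (m ^ 2), k, ?_, ?_⟩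
  · rw [orderOf_dvd_iff_pow_eq_one, ← pow_mul]
    apply orderOf_dvd_iff_pow_eq_one.1
    rw [hkm]
    exact ⟨m, by ring⟩
  · have hmod : m ^ 2 % 3 = 1 := by
      have : m % 3 = 1 ∨ m % 3 = 2 := by omega
      rcases this with h | h <;> simp [Nat.pow_mod, h]
    rw [QuotientGroup.mk_pow, ← Nat.div_add_mod (m ^ 2) 3, hmod, pow_add, pow_mul, ha, one_pow,
      one_mul, pow_one]

/-- For every `n` and every subgroup `H ≤ Aₙ`, the group
`F(Aₙ, H) = (H ∩ [Aₙ, Aₙ]) / Φ^{Aₙ}(H)` is either trivial, cyclic of order 3, or an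
elementary abelian 2-group: either every element of `F(Aₙ,H)` has order dividing 2, or
`F(Aₙ,H)` is isomorphic to `ℤ/3ℤ`. -/
theorem FGroup_alternating_classification (n : ℕ)
    (H : Subgroup ↥(alternatingGroup (Fin n))) :
    (∀ x : FGroup H, x ^ 2 = 1) ∨
    Nonempty (FGroup H ≃* Multiplicative (ZMod 3)) := by
  have sq_of_conj (x : ↥(H ⊓ commutator ↥(alternatingGroup (Fin n))))
      (h : ∃ g : alternatingGroup (Fin n), g⁻¹ * x * g = (x : alternatingGroup (Fin n))⁻¹) :
      (x : FGroup H) ^ 2 = 1 := by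
    have hx : (x : FGroup H) = (x : FGroup H)⁻¹ := FGroup.mk_eq_mk_of_conj (y := x⁻¹) h
    rw [pow_two]
    exact mul_eq_one_iff_eq_inv.2 hx
  have sq_or_cube (a : FGroup H) : a ^ 2 = 1 ∨ a ^ 3 = 1 := by
    obtain ⟨x, rfl⟩ := QuotientGroup.mk_surjective a
    refine (alternatingGroup.exists_inv_mul_mul_eq_inv_or_pow_four x.1).imp
      (sq_of_conj x) fun h => ?_
    have hx : (x : FGroup H) = (x : FGroup H) ^ 4 := FGroup.mk_eq_mk_of_conj (y := x ^ 4) h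
    rwa [pow_succ, right_eq_mul] at hx
  refine or_iff_not_imp_left.2 fun hsq => ?_
  obtain ⟨a, ha⟩ := not_forall.1 hsq
  have ha3 : a ^ 3 = 1 := (sq_or_cube a).resolve_left ha
  have cube (b : FGroup H) : b ^ 3 = 1 := by
    have hab : Commute a b := FGroup.mul_comm a b
    rcases sq_or_cube b with hb | hb
    · rcases sq_or_cube (a * b) with h | h
      · rw [hab.mul_pow, hb, mul_one] at h
        exact absurd h ha
      · rwa [hab.mul_pow, ha3, one_mul] at h
    · exact hb
  have mem_zpowers (b : FGroup H) : b ∈ Subgroup.zpowers a := by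
    by_cases hb : b ^ 2 = 1
    · have hb1 : b = 1 := by simpa [pow_succ, hb] using cube b
      exact hb1 ▸ one_mem _
    obtain ⟨x, k, hx, rfl⟩ := QuotientGroup.exists_mk_eq_of_pow_three_eq_one ha3
    obtain ⟨y, l, hy, rfl⟩ := QuotientGroup.exists_mk_eq_of_pow_three_eq_one (cube b)
    rw [← Subgroup.orderOf_coe] at hx hy
    rcases alternatingGroup.exists_inv_mul_mul_eq_or_eq_inv Nat.prime_three hy hx
      (fun h => hb (sq_of_conj y h)) (fun h => ha (sq_of_conj x h)) with h | h
    · rw [FGroup.mk_eq_mk_of_conj h]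
      exact Subgroup.mem_zpowers _
    · rw [FGroup.mk_eq_mk_of_conj (y := x⁻¹) h, QuotientGroup.mk_inv]
      exact inv_mem (Subgroup.mem_zpowers _)
  have hcard : Nat.card (FGroup H) = 3 := by
    rw [← orderOf_eq_card_of_forall_mem_zpowers mem_zpowers]
    exact orderOf_eq_prime ha3 fun h => ha (by rw [h, one_pow])
  have : Fact (Nat.Prime 3) := ⟨Nat.prime_three⟩
  exact ⟨mulEquivOfPrimeCardEq (p := 3) hcard (by simp)⟩
end

section
/- Let n be a natural number, H a subgroup of the alternating group A_n, and h ∈ H an element of odd order. Then h³ lies in the focal subgroup Φ^{A_n}(H). (Consequently, every element of odd order in F(A_n,H) is 3-torsion.) -/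
set_option synthInstance.maxHeartbeats 1000000
set_option maxHeartbeats 1000000

/-- Raising a permutation to a power coprime to its order preserves its cycle type. -/
theorem cycleType_pow_of_coprime {α : Type*} [Fintype α] [DecidableEq α]
    (σ : Equiv.Perm α) {k : ℕ} (hk : (orderOf σ).Coprime k) :
    (σ ^ k).cycleType = σ.cycleType := by
  induction σ using Equiv.Perm.cycle_induction_on with
  | base_one => simp
  | base_cycles σ hσ =>
      have hσk : (σ ^ k).IsCycle := hσ.pow_iff.mpr hk.symm
      rw [hσ.cycleType, hσk.cycleType, Equiv.Perm.support_pow_coprime hk.symm]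
  | induction_disjoint σ τ hd _ hσ hτ =>
      rw [hd.orderOf] at hk
      rw [hd.commute.mul_pow, (hd.pow_disjoint_pow k k).cycleType_mul, hd.cycleType_mul,
        hσ (hk.coprime_dvd_left (Nat.dvd_lcm_left _ _)),
        hτ (hk.coprime_dvd_left (Nat.dvd_lcm_right _ _))]

/-- If `H ≤ Aₙ` and `h ∈ H` has odd order, then `h ^ 3` lies in the focal
subgroup `Φ^{Aₙ}(H)`. -/
theorem cube_mem_focal_of_odd_order (n : ℕ)
    (H : Subgroup ↥(alternatingGroup (Fin n)))
    (h : ↥(alternatingGroup (Fin n))) (hH : h ∈ H) (hodd : Odd (orderOf h)) :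
    h ^ 3 ∈ focal H := by
  have hcop : (orderOf (h : Equiv.Perm (Fin n))).Coprime 2 := by
    rw [Subgroup.orderOf_coe]
    exact hodd.coprime_two_right
  obtain ⟨c, hc⟩ := isConj_iff.mp
    (Equiv.Perm.isConj_iff_cycleType_eq.mpr (cycleType_pow_of_coprime _ hcop).symm)
  have hc2 : c * (c * h * c⁻¹) * c⁻¹ = (h : Equiv.Perm (Fin n)) ^ 4 := by
    rw [hc, ← conj_pow, hc, ← pow_mul]
  let g : alternatingGroup (Fin n) :=
    ⟨(c * c)⁻¹, by
      rw [Equiv.Perm.mem_alternatingGroup, map_inv, map_mul, Int.units_mul_self, inv_one]⟩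
  have hg : g⁻¹ * h * g = h ^ 4 := by
    apply Subtype.ext
    simpa [g, mul_assoc] using hc2
  refine Subgroup.subset_closure ⟨h, hH, g, ?_, ?_⟩
  · rw [hg]
    exact H.pow_mem hH 4
  · rw [hg]
    group
end

section
/- Let n be a natural number and let H be a subgroup of the alternating group A_n whose order is a power of 3. Then the group F(A_n, H) = (H ∩ [A_n, A_n]) / Φ^{A_n}(H) is cyclic of order dividing 3 (i.e., it is either trivial or isomorphic to ℤ/3ℤ). -/
set_option synthInstance.maxHeartbeats 1000000
set_option maxHeartbeats 1000000

/-- A multiset of distinct powers of `3` is determined by its sum. -/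
theorem Multiset.eq_of_sum_eq_of_three_pow {s t : Multiset ℕ}
    (hs : ∀ a ∈ s, ∃ i, a = 3 ^ i) (ht : ∀ a ∈ t, ∃ i, a = 3 ^ i)
    (hsn : s.Nodup) (htn : t.Nodup) (h : s.sum = t.sum) : s = t := by
  have key : ∀ u : Multiset ℕ, (∀ a ∈ u, ∃ i, a = 3 ^ i) → u.Nodup →
      ∃ A : Finset ℕ, u = A.val.map (fun i => 3 ^ i) := by
    intro u hu hun
    have hmap : (u.map (Nat.log 3)).map (fun i => 3 ^ i) = u := by
      rw [Multiset.map_map]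
      conv_rhs => rw [← Multiset.map_id u]
      refine Multiset.map_congr rfl fun a ha => ?_
      obtain ⟨i, rfl⟩ := hu a ha
      simp [Nat.log_pow]
    have hn : (u.map (Nat.log 3)).Nodup := by
      refine Multiset.Nodup.of_map (fun i => 3 ^ i) ?_
      rwa [hmap]
    exact ⟨⟨_, hn⟩, hmap.symm⟩
  obtain ⟨A, rfl⟩ := key s hs hsn
  obtain ⟨B, rfl⟩ := key t ht htn
  have hAB : A = B := Finset.geomSum_injective (n := 3) (by norm_num) h
  rw [hAB]

/-- Permutations of `3`-power order whose centralizers consist of even permutations all have the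
same cycle type. -/
theorem Equiv.Perm.cycleType_eq_of_centralizer_le_alternatingGroup_s4 {α : Type*} [Fintype α]
    [DecidableEq α] {σ τ : Equiv.Perm α} {a b : ℕ} (hσ : orderOf σ = 3 ^ a)
    (hτ : orderOf τ = 3 ^ b) (hσc : Subgroup.centralizer {σ} ≤ alternatingGroup α)
    (hτc : Subgroup.centralizer {τ} ≤ alternatingGroup α) : σ.cycleType = τ.cycleType := by
  have pow : ∀ {ρ : Equiv.Perm α} {m : ℕ}, orderOf ρ = 3 ^ m →
      ∀ c ∈ ρ.cycleType, ∃ i, c = 3 ^ i := by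
    intro ρ m hρ c hc
    obtain ⟨i, -, hi⟩ := (Nat.dvd_prime_pow Nat.prime_three).1
      (hρ ▸ Equiv.Perm.dvd_of_mem_cycleType hc)
    exact ⟨i, hi⟩
  have three_dvd : ∀ {ρ : Equiv.Perm α} {m : ℕ}, orderOf ρ = 3 ^ m → 3 ∣ ρ.cycleType.sum := by
    intro ρ m hρ
    refine Multiset.dvd_sum fun c hc => ?_
    obtain ⟨i, rfl⟩ := pow hρ c hc
    refine dvd_pow_self 3 fun hi => ?_
    have := Equiv.Perm.two_le_of_mem_cycleType hc
    simp [hi] at this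
  obtain ⟨-, hσs, hσn⟩ := Equiv.Perm.centralizer_le_alternating_iff.1 hσc
  obtain ⟨-, hτs, hτn⟩ := Equiv.Perm.centralizer_le_alternating_iff.1 hτc
  have hσ3 := three_dvd hσ
  have hτ3 := three_dvd hτ
  have hσle := σ.sum_cycleType_le
  have hτle := τ.sum_cycleType_le
  exact Multiset.eq_of_sum_eq_of_three_pow (pow hσ) (pow hτ)
    (Multiset.nodup_iff_count_le_one.2 hσn) (Multiset.nodup_iff_count_le_one.2 hτn) (by omega)

/-- A nontrivial group in which all cubes are trivial and any two nontrivial elements are equal or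
mutually inverse is cyclic of order three. -/
theorem subsingleton_or_nonempty_mulEquiv_zmod_three {Q : Type*} [Group Q]
    (h3 : ∀ x : Q, x ^ 3 = 1) (h : ∀ x y : Q, x ≠ 1 → y ≠ 1 → x = y ∨ x = y⁻¹) :
    Subsingleton Q ∨ Nonempty (Q ≃* Multiplicative (ZMod 3)) := by
  rcases subsingleton_or_nontrivial Q with hQ | hQ
  · exact Or.inl hQ
  obtain ⟨g, hg⟩ := exists_ne (1 : Q)
  have hgen : ∀ x : Q, x ∈ Subgroup.zpowers g := by
    intro x
    by_cases hx : x = 1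
    · exact hx ▸ one_mem _
    rcases h x g hx hg with rfl | rfl
    · exact Subgroup.mem_zpowers _
    · exact inv_mem (Subgroup.mem_zpowers _)
  have : Fact (Nat.Prime 3) := ⟨Nat.prime_three⟩
  have hcard : Nat.card Q = 3 :=
    (orderOf_eq_card_of_forall_mem_zpowers hgen).symm.trans (orderOf_eq_prime (h3 g) hg)
  exact Or.inr ⟨(zmodMulEquivOfGenerator hgen hcard).symm⟩

section AlternatingGroup

variable {n : ℕ} {H : Subgroup ↥(alternatingGroup (Fin n))}

theorem inv_mul_mem_focal {h k : ↥(alternatingGroup (Fin n))} (hh : h ∈ H) (hk : k ∈ H)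
    {g : Equiv.Perm (Fin n)} (hg : Equiv.Perm.sign g = 1)
    (hgk : g * (h : Equiv.Perm (Fin n)) * g⁻¹ = k) : h⁻¹ * k ∈ focal H := by
  obtain ⟨c, hc⟩ : ∃ c : ↥(alternatingGroup (Fin n)), (c : Equiv.Perm (Fin n)) = g⁻¹ :=
    ⟨⟨g⁻¹, by simp [Equiv.Perm.mem_alternatingGroup, hg]⟩, rfl⟩
  have hconj : c⁻¹ * h * c = k := by
    apply Subtype.ext
    simpa [hc] using hgk
  exact Subgroup.subset_closure ⟨h, hh, c, by rwa [hconj], by rw [hconj]⟩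

theorem exists_orderOf_eq_three_pow (hcard : ∃ m : ℕ, Nat.card H = 3 ^ m)
    {h : ↥(alternatingGroup (Fin n))} (hh : h ∈ H) :
    ∃ a : ℕ, orderOf (h : Equiv.Perm (Fin n)) = 3 ^ a := by
  obtain ⟨m, hm⟩ := hcard
  obtain ⟨a, -, ha⟩ := (Nat.dvd_prime_pow Nat.prime_three).1
    (hm ▸ H.orderOf_dvd_natCard hh)
  exact ⟨a, by rw [Subgroup.orderOf_coe, ha]⟩

/-- An element of `3`-power order inverted by an even permutation is in the focal subgroup. -/
theorem mem_focal_of_conj_inv (hcard : ∃ m : ℕ, Nat.card H = 3 ^ m)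
    {h : ↥(alternatingGroup (Fin n))} (hh : h ∈ H)
    {g : Equiv.Perm (Fin n)} (hg : Equiv.Perm.sign g = 1)
    (hgh : g * (h : Equiv.Perm (Fin n)) * g⁻¹ = (h : Equiv.Perm (Fin n))⁻¹) : h ∈ focal H := by
  have h2 : h⁻¹ * h⁻¹ ∈ focal H := inv_mul_mem_focal hh (inv_mem hh) hg (by simpa using hgh)
  have h2' : h ^ 2 ∈ focal H := by simpa [pow_two] using inv_mem h2
  obtain ⟨a, ha⟩ := exists_orderOf_eq_three_pow hcard hh
  rw [Subgroup.orderOf_coe] at ha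
  have hco : (orderOf h).Coprime 2 := by
    rw [ha]
    exact Nat.Coprime.pow_left a (by norm_num)
  obtain ⟨m, hm⟩ := exists_pow_eq_self_of_coprime hco.symm
  exact hm ▸ pow_mem h2' m

theorem exists_conj_inv (σ : Equiv.Perm (Fin n)) : ∃ g, g * σ * g⁻¹ = σ⁻¹ :=
  isConj_iff.1 (Equiv.Perm.isConj_of_cycleType_eq σ.cycleType_inv.symm)

theorem centralizer_le_of_notMem_focal (hcard : ∃ m : ℕ, Nat.card H = 3 ^ m)
    {h : ↥(alternatingGroup (Fin n))} (hh : h ∈ H) (hf : h ∉ focal H) :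
    Subgroup.centralizer {(h : Equiv.Perm (Fin n))} ≤ alternatingGroup (Fin n) := by
  intro c hc
  rw [Subgroup.mem_centralizer_singleton_iff] at hc
  obtain ⟨g, hg⟩ := exists_conj_inv (h : Equiv.Perm (Fin n))
  have hgs : Equiv.Perm.sign g ≠ 1 := fun hs => hf (mem_focal_of_conj_inv hcard hh hs hg)
  rw [Equiv.Perm.mem_alternatingGroup]
  by_contra hcs
  refine hf (mem_focal_of_conj_inv hcard hh (g := g * c) ?_ ?_)
  · rw [Equiv.Perm.sign_mul, Int.units_ne_iff_eq_neg.1 hgs, Int.units_ne_iff_eq_neg.1 hcs]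
    simp
  · rw [← hg, mul_assoc g c, hc]
    group

theorem cycleType_eq_of_notMem_focal (hcard : ∃ m : ℕ, Nat.card H = 3 ^ m)
    {h k : ↥(alternatingGroup (Fin n))} (hh : h ∈ H) (hk : k ∈ H)
    (hhf : h ∉ focal H) (hkf : k ∉ focal H) :
    (h : Equiv.Perm (Fin n)).cycleType = (k : Equiv.Perm (Fin n)).cycleType := by
  obtain ⟨a, ha⟩ := exists_orderOf_eq_three_pow hcard hh
  obtain ⟨b, hb⟩ := exists_orderOf_eq_three_pow hcard hk
  exact Equiv.Perm.cycleType_eq_of_centralizer_le_alternatingGroup_s4 ha hb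
    (centralizer_le_of_notMem_focal hcard hh hhf) (centralizer_le_of_notMem_focal hcard hk hkf)

theorem pow_three_mem_focal (hcard : ∃ m : ℕ, Nat.card H = 3 ^ m)
    {h : ↥(alternatingGroup (Fin n))} (hh : h ∈ H) : h ^ 3 ∈ focal H := by
  by_contra h3
  have hf : h ∉ focal H := fun hf => h3 (pow_mem hf 3)
  have hct := cycleType_eq_of_notMem_focal hcard hh (pow_mem hh 3) hf h3
  obtain ⟨a, ha⟩ := exists_orderOf_eq_three_pow hcard hh
  have hord : orderOf (h ^ 3) = orderOf h := by
    rw [← Subgroup.orderOf_coe, ← Subgroup.orderOf_coe h, ← Equiv.Perm.lcm_cycleType,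
      ← Equiv.Perm.lcm_cycleType, hct]
  rw [Subgroup.orderOf_coe] at ha
  cases a with
  | zero =>
    rw [pow_zero, orderOf_eq_one_iff] at ha
    exact hf (ha ▸ one_mem _)
  | succ a =>
    rw [orderOf_pow_of_dvd (by norm_num) (ha ▸ dvd_pow_self 3 a.succ_ne_zero), ha] at hord
    exact (Nat.div_lt_self (by positivity) (by norm_num)).ne hord

theorem inv_mul_mem_focal_or (hcard : ∃ m : ℕ, Nat.card H = 3 ^ m)
    {h k : ↥(alternatingGroup (Fin n))} (hh : h ∈ H) (hk : k ∈ H)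
    (hhf : h ∉ focal H) (hkf : k ∉ focal H) :
    h⁻¹ * k ∈ focal H ∨ h⁻¹ * k⁻¹ ∈ focal H := by
  obtain ⟨g, hg⟩ := isConj_iff.1 (Equiv.Perm.isConj_of_cycleType_eq
    (cycleType_eq_of_notMem_focal hcard hh hk hhf hkf))
  by_cases hgs : Equiv.Perm.sign g = 1
  · exact Or.inl (inv_mul_mem_focal hh hk hgs hg)
  obtain ⟨c, hc⟩ := exists_conj_inv (h : Equiv.Perm (Fin n))
  have hcs : Equiv.Perm.sign c ≠ 1 := fun hs => hhf (mem_focal_of_conj_inv hcard hh hs hc)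
  refine Or.inr (inv_mul_mem_focal hh (inv_mem hk) (g := g * c) ?_ ?_)
  · rw [Equiv.Perm.sign_mul, Int.units_ne_iff_eq_neg.1 hgs, Int.units_ne_iff_eq_neg.1 hcs]
    simp
  · calc g * c * (h : Equiv.Perm (Fin n)) * (g * c)⁻¹
        = g * (c * (h : Equiv.Perm (Fin n)) * c⁻¹) * g⁻¹ := by group
      _ = (g * (h : Equiv.Perm (Fin n)) * g⁻¹)⁻¹ := by rw [hc]; group
      _ = _ := by rw [hg]; simp

end AlternatingGroup

/-- If `H ≤ Aₙ` has order a power of 3, then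
`F(Aₙ, H) = (H ∩ [Aₙ, Aₙ]) / Φ^{Aₙ}(H)` is cyclic of order dividing 3: it is either
trivial or isomorphic to `ℤ/3ℤ`. -/
theorem FGroup_of_three_group (n : ℕ)
    (H : Subgroup ↥(alternatingGroup (Fin n)))
    (hcard : ∃ m : ℕ, Nat.card H = 3 ^ m) :
    Subsingleton (FGroup H) ∨ Nonempty (FGroup H ≃* Multiplicative (ZMod 3)) := by
  refine subsingleton_or_nonempty_mulEquiv_zmod_three ?_ ?_
  · intro x
    obtain ⟨h, rfl⟩ := QuotientGroup.mk_surjective x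
    rw [← QuotientGroup.mk_pow, QuotientGroup.eq_one_iff, Subgroup.mem_subgroupOf]
    exact pow_three_mem_focal hcard h.2.1
  · intro x y hx hy
    obtain ⟨h, rfl⟩ := QuotientGroup.mk_surjective x
    obtain ⟨k, rfl⟩ := QuotientGroup.mk_surjective y
    rw [Ne, QuotientGroup.eq_one_iff, Subgroup.mem_subgroupOf] at hx hy
    rw [← QuotientGroup.mk_inv, QuotientGroup.eq, QuotientGroup.eq, Subgroup.mem_subgroupOf,
      Subgroup.mem_subgroupOf]
    exact inv_mul_mem_focal_or hcard h.2.1 k.2.1 hx hy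
end

section
/- For every natural number k ≥ 0 there exist a natural number n and a subgroup H of the alternating group A_n such that both F(A_n, H) and F(S_n, H) are isomorphic to the elementary abelian group (ℤ/2ℤ)^k. (In the construction one may take H ≅ (ℤ/2ℤ)^k with Φ^{A_n}(H) = Φ^{S_n}(H) = 1 and H contained in [A_n,A_n] and [S_n,S_n].) -/
set_option synthInstance.maxHeartbeats 1000000
set_option maxHeartbeats 1000000

/-- If an injective homomorphism `f : M →* G` separates elements up to conjugacy in `G` and its
image lies in the commutator subgroup, then `F(G, f(M))` is isomorphic to `M`. -/
theorem nonempty_FGroup_range_mulEquiv {G M : Type*} [Group G] [Group M] (f : M →* G)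
    (hconj : ∀ a b, IsConj (f a) (f b) → a = b) (hcomm : f.range ≤ commutator G) :
    Nonempty (FGroup f.range ≃* M) := by
  have hinj : Function.Injective f := fun a b h => hconj a b (h ▸ IsConj.refl _)
  have hfocal : focal f.range = ⊥ := by
    rw [focal, Subgroup.closure_eq_bot_iff]
    rintro _ ⟨_, ⟨a, rfl⟩, g, ⟨b, hb⟩, rfl⟩
    have hab : a = b := hconj a b (isConj_iff.2 ⟨g⁻¹, by rw [hb, inv_inv]⟩)
    rw [← hb, hab, inv_mul_cancel]
    exact Set.mem_singleton 1
  have hsub : (focal f.range).subgroupOf (f.range ⊓ commutator G) = ⊥ := by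
    rw [hfocal, Subgroup.bot_subgroupOf]
  exact ⟨(QuotientGroup.quotientMulEquivOfEq hsub).trans <| QuotientGroup.quotientBot.trans <|
    (MulEquiv.subgroupCongr (inf_eq_left.2 hcomm)).trans (MonoidHom.ofInjective hinj).symm⟩

namespace BinaryBlocks

/-- Labels of blocks: `2 ^ i` blocks for each coordinate `i`, and one further block. -/
abbrev Block (k : ℕ) := Option (Σ i : Fin k, Fin (2 ^ (i : ℕ)))

/-- The translation by which a vector acts on the block with the given label. -/
def shift {k : ℕ} (v : Fin k → ZMod 2) : Block k → ZMod 2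
  | none => 0
  | some j => v j.1

theorem shift_add {k : ℕ} (v w : Fin k → ZMod 2) (j : Block k) :
    shift (v + w) j = shift v j + shift w j := by
  cases j <;> simp [shift]

/-- The points permuted: six copies of `ZMod 2` for each block. -/
abbrev Point (k : ℕ) := Block k × Fin 6 × ZMod 2

/-- The action of `(ZMod 2) ^ k` on points by blockwise translation. -/
def action (k : ℕ) : Multiplicative (Fin k → ZMod 2) →* Equiv.Perm (Point k) where
  toFun v := Equiv.prodCongrRight fun j => Equiv.prodCongrRight fun _ =>
    Equiv.addRight (shift v.toAdd j)
  map_one' := by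
    ext ⟨j, l, x⟩ : 1
    cases j <;> simp [shift]
  map_mul' v w := by
    ext ⟨j, l, x⟩ : 1
    simp [shift_add, add_comm, add_left_comm]

theorem sign_action {k : ℕ} (v : Multiplicative (Fin k → ZMod 2)) :
    Equiv.Perm.sign (action k v) = 1 := by
  simp only [action, MonoidHom.coe_mk, OneHom.coe_mk, Equiv.Perm.sign_prodCongrRight,
    Finset.prod_const, Finset.card_univ, Fintype.card_fin]
  refine Finset.prod_eq_one fun j _ => ?_
  rw [show (6 : ℕ) = 2 * 3 from rfl, pow_mul, Int.units_sq, one_pow]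

theorem card_support_action {k : ℕ} (v : Multiplicative (Fin k → ZMod 2)) :
    (action k v).support.card =
      12 * ∑ i ∈ (Finset.univ.filter fun i => v.toAdd i ≠ 0).map Fin.valEmbedding, 2 ^ i := by
  have hmoved : ∀ x : Point k, action k v x ≠ x ↔ shift v.toAdd x.1 ≠ 0 := by
    rintro ⟨j, l, x⟩
    simp [action]
  simp only [Equiv.Perm.support, hmoved, Finset.card_filter, Fintype.sum_prod_type,
    Fintype.sum_option, Fintype.sum_sigma, shift, Finset.sum_map, Finset.sum_filter,
    Finset.mul_sum]
  simp only [Finset.sum_const, Finset.card_univ, Fintype.card_fin, ZMod.card, smul_eq_mul,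
    ne_eq, not_true_eq_false, if_false, mul_zero, zero_add]
  refine Finset.sum_congr rfl fun i _ => ?_
  split_ifs
  · simp
  · simp [mul_comm]

theorem eq_of_isConj_action {k : ℕ} {v w : Multiplicative (Fin k → ZMod 2)}
    (h : IsConj (action k v) (action k w)) : v = w := by
  obtain ⟨g, hg⟩ := isConj_iff.1 h
  have hcard : (action k v).support.card = (action k w).support.card := by
    rw [← hg, Equiv.Perm.card_support_conj]
  rw [card_support_action, card_support_action] at hcard
  have hset := Finset.map_injective _ <|
    Finset.geomSum_injective le_rfl (Nat.eq_of_mul_eq_mul_left (by norm_num) hcard)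
  have hZMod : ∀ a b : ZMod 2, (a ≠ 0 ↔ b ≠ 0) → a = b := by decide
  refine Multiplicative.toAdd.injective (funext fun i => hZMod _ _ ?_)
  simpa using Finset.ext_iff.1 hset i

end BinaryBlocks

open BinaryBlocks in
/-- For every `k ≥ 0` there exist `n` and a subgroup `H ≤ Aₙ` such that both
`F(Aₙ, H)` and `F(Sₙ, H)` are isomorphic to the elementary abelian group `(ℤ/2ℤ)^k`. -/
theorem exists_FGroup_elementary_abelian (k : ℕ) :
    ∃ (n : ℕ) (H : Subgroup ↥(alternatingGroup (Fin n))),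
      Nonempty (FGroup H ≃* Multiplicative (Fin k → ZMod 2)) ∧
      Nonempty (FGroup (H.map (alternatingGroup (Fin n)).subtype) ≃*
        Multiplicative (Fin k → ZMod 2)) := by
  let e := Fintype.equivFin (Point k)
  let f : Multiplicative (Fin k → ZMod 2) →* Equiv.Perm (Fin (Fintype.card (Point k))) :=
    e.permCongrHom.toMonoidHom.comp (action k)
  have hconj : ∀ a b, IsConj (f a) (f b) → a = b := fun a b h => eq_of_isConj_action <| by
    simpa only [f, MonoidHom.comp_apply, MulEquiv.toMonoidHom_eq_coe, MonoidHom.coe_coe,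
      MulEquiv.symm_apply_apply] using e.permCongrHom.symm.toMonoidHom.map_isConj h
  have hmem : ∀ v, f v ∈ alternatingGroup (Fin (Fintype.card (Point k))) := fun v => by
    rw [Equiv.Perm.mem_alternatingGroup]
    exact (Equiv.Perm.sign_permCongr e _).trans (sign_action v)
  have hcard : 5 ≤ Nat.card (Fin (Fintype.card (Point k))) := by
    rw [Nat.card_fin, Fintype.card_prod, Fintype.card_prod, Fintype.card_fin, ZMod.card]
    have := Fintype.card_pos (α := Block k)
    omega
  let f' := f.codRestrict (alternatingGroup (Fin (Fintype.card (Point k)))) hmem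
  refine ⟨_, f'.range, nonempty_FGroup_range_mulEquiv f' (fun a b h => hconj a b ?_) ?_, ?_⟩
  · exact (alternatingGroup (Fin (Fintype.card (Point k)))).subtype.map_isConj h
  · rw [commutator_alternatingGroup_eq_top hcard]
    exact le_top
  · rw [MonoidHom.map_range]
    refine nonempty_FGroup_range_mulEquiv _ hconj ?_
    rw [alternatingGroup.commutator_perm_eq hcard]
    rintro _ ⟨v, rfl⟩
    exact hmem v
end

section
/- Let l ≥ 0, let n = 3^l, let ρ ∈ S_n be a cycle of length 3^l (i.e., an n-cycle whose support is all of {1,…,n}), and let j be an integer with j ≡ −1 (mod 3). Then ρ^j is conjugate to ρ by an element of the alternating group A_n (i.e., there exists σ ∈ A_n with σρσ⁻¹ = ρ^j) if and only if l is even. -/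
theorem conj_pow_of_conj_eq_zpow {G : Type*} [Group G] {g h : G} {j : ℤ}
    (hgh : g * h * g⁻¹ = h ^ j) (m : ℕ) : g ^ m * h * (g ^ m)⁻¹ = h ^ (j ^ m) := by
  induction m with
  | zero => simp
  | succ m ih =>
    calc g ^ (m + 1) * h * (g ^ (m + 1))⁻¹ = g * (g ^ m * h * (g ^ m)⁻¹) * g⁻¹ := by
          rw [pow_succ']; group
      _ = (g * h * g⁻¹) ^ (j ^ m) := by rw [ih, conj_zpow]
      _ = h ^ (j ^ (m + 1)) := by rw [hgh, ← zpow_mul, pow_succ']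

/-- A permutation inverting a cycle of odd length that moves every point is a product of
`(card α - 1) / 2` disjoint transpositions. -/
theorem Equiv.Perm.sign_of_conj_cycle_eq_inv {α : Type*} [Fintype α] [DecidableEq α]
    {ρ τ : Equiv.Perm α} (hρ : ρ.IsCycleOn (Finset.univ : Finset α)) (hodd : Odd (Fintype.card α))
    (hτ : τ * ρ * τ⁻¹ = ρ⁻¹) :
    Equiv.Perm.sign τ = (-1) ^ ((Fintype.card α - 1) / 2) := by
  have hconj (k : ℤ) (x : α) : τ ((ρ ^ k) x) = (ρ ^ (-k)) (τ x) := by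
    have h : τ * ρ ^ k * τ⁻¹ = ρ ^ (-k) := by rw [← conj_zpow, hτ, inv_zpow, zpow_neg]
    simp [← h]
  have hsame (x y : α) : ∃ k : ℤ, (ρ ^ k) x = y :=
    hρ.2 (Finset.mem_coe.2 (Finset.mem_univ x)) (Finset.mem_coe.2 (Finset.mem_univ y))
  have hsq : τ ^ 2 = 1 := by
    ext x
    obtain ⟨k, hk⟩ := hsame x (τ x)
    calc (τ ^ 2) x = τ ((ρ ^ k) x) := by rw [hk, pow_two, Equiv.Perm.mul_apply]
      _ = (ρ ^ (-k) * ρ ^ k) x := by rw [hconj, ← hk, Equiv.Perm.mul_apply]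
      _ = (1 : Equiv.Perm α) x := by rw [← zpow_add, neg_add_cancel, zpow_zero]
  obtain ⟨a, ha⟩ : ∃ a, τ a = a :=
    Equiv.Perm.exists_fixed_point_of_prime (p := 2) (n := 1)
      (by rwa [← even_iff_two_dvd, Nat.not_even_iff_odd]) (by simpa using hsq)
  have hfix : Fintype.card (Function.fixedPoints τ) = 1 := by
    refine Fintype.card_eq_one_iff.2 ⟨⟨a, ha⟩, fun ⟨b, hb⟩ => Subtype.ext ?_⟩
    obtain ⟨k, rfl⟩ := hsame a b
    have hb' : (ρ ^ (-k)) a = (ρ ^ k) a := by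
      have := hconj k a
      rw [ha] at this
      exact this.symm.trans hb
    have h2 : (ρ ^ (2 * k)) a = a := by
      rw [two_mul, zpow_add, Equiv.Perm.mul_apply, ← hb', ← Equiv.Perm.mul_apply, ← zpow_add]
      simp
    rw [hρ.zpow_apply_eq (Finset.mem_univ a), Finset.card_univ] at h2
    refine (hρ.zpow_apply_eq (Finset.mem_univ a)).2 (Int.dvd_of_dvd_mul_right_of_gcd_one h2 ?_)
    exact (Nat.coprime_two_right.2 hodd)
  rw [Equiv.Perm.sign_of_pow_two_eq_one hsq, hfix]

theorem Int.three_pow_dvd_pow_add_one {j : ℤ} (hj : Int.ModEq 3 j (-1)) (l : ℕ) :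
    (3 : ℤ) ^ (l + 1) ∣ j ^ 3 ^ l + 1 := by
  have h := dvd_sub_pow_of_dvd_sub (p := 3) (a := j) (b := -1) (by exact_mod_cast hj.symm.dvd) l
  rwa [Odd.neg_one_pow (Odd.pow (by decide)), sub_neg_eq_add] at h

theorem Nat.even_three_pow_sub_one_div_two_iff (l : ℕ) : Even ((3 ^ l - 1) / 2) ↔ Even l := by
  induction l with
  | zero => simp
  | succ l ih =>
    obtain ⟨m, hm⟩ : Odd (3 ^ l) := Odd.pow (by decide)
    rw [Nat.even_add_one, ← ih, pow_succ, hm]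
    grind

/-- A power of a finite cycle with exponent coprime to its order is conjugate to it. -/
theorem Equiv.Perm.IsCycle.isConj_zpow {α : Type*} [Fintype α] [DecidableEq α]
    {ρ : Equiv.Perm α} (hρ : ρ.IsCycle) {j : ℤ} (hj : IsCoprime j (orderOf ρ : ℤ)) :
    IsConj ρ (ρ ^ j) := by
  have hpos : (0 : ℤ) < orderOf ρ := by exact_mod_cast orderOf_pos ρ
  obtain ⟨k, hk⟩ := Int.eq_ofNat_of_zero_le (Int.emod_nonneg j hpos.ne')
  have hkj : ρ ^ j = ρ ^ k := by rw [← zpow_mod_orderOf, hk, zpow_natCast]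
  have hcop : k.Coprime (orderOf ρ) := by
    rw [← Nat.isCoprime_iff_coprime, ← hk, Int.emod_def, sub_eq_add_neg, ← mul_neg]
    exact hj.add_mul_left_left _
  rw [hkj]
  exact hρ.isConj (hρ.pow_iff.2 hcop) (by rw [Equiv.Perm.support_pow_coprime hcop])

/-- Let `n = 3 ^ l`, let `ρ ∈ Sₙ` be a cycle of length `3 ^ l` (an `n`-cycle
whose support is all of `{1, …, n}`), and let `j` be an integer with `j ≡ -1 (mod 3)`.
Then `ρ ^ j` is conjugate to `ρ` by an element of the alternating group `Aₙ` if and only if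
`l` is even. -/
theorem conj_pow_cycle_alternating_iff (l n : ℕ) (hn : n = 3 ^ l)
    (ρ : Equiv.Perm (Fin n)) (hcyc : ρ.IsCycle) (hsupp : ρ.support = Finset.univ)
    (j : ℤ) (hj : Int.ModEq 3 j (-1)) :
    (∃ σ ∈ alternatingGroup (Fin n), σ * ρ * σ⁻¹ = ρ ^ j) ↔ Even l := by
  have horder : orderOf ρ = 3 ^ l := by
    rw [hcyc.orderOf, hsupp, Finset.card_univ, Fintype.card_fin, hn]
  have hρ : ρ.IsCycleOn (Finset.univ : Finset (Fin n)) := by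
    rw [← hsupp]
    exact Equiv.Perm.coe_support_eq_set_support ρ ▸ hcyc.isCycleOn
  have hl : l ≠ 0 := by
    rintro rfl
    exact hcyc.ne_one (orderOf_eq_one_iff.1 (by simpa using horder))
  obtain ⟨m, rfl⟩ := Nat.exists_eq_succ_of_ne_zero hl
  have hsign (σ : Equiv.Perm (Fin n)) (hσ : σ * ρ * σ⁻¹ = ρ ^ j) :
      Equiv.Perm.sign σ = (-1) ^ ((n - 1) / 2) := by
    have hinv : σ ^ 3 ^ m * ρ * (σ ^ 3 ^ m)⁻¹ = ρ⁻¹ := by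
      rw [conj_pow_of_conj_eq_zpow hσ, eq_inv_iff_mul_eq_one, ← zpow_add_one,
        ← orderOf_dvd_iff_zpow_eq_one, horder]
      exact_mod_cast Int.three_pow_dvd_pow_add_one hj m
    have h := Equiv.Perm.sign_of_conj_cycle_eq_inv hρ
      (by rw [Fintype.card_fin, hn]; exact Odd.pow (by decide)) hinv
    have hodd : Odd (3 ^ m) := Odd.pow (by decide)
    rwa [map_pow, Int.units_pow_eq_pow_mod_two, Nat.odd_iff.1 hodd, pow_one,
      Fintype.card_fin] at h
  have hparity : (-1 : ℤˣ) ^ ((n - 1) / 2) = 1 ↔ Even (m + 1) := by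
    rw [neg_one_pow_eq_one_iff_even (by decide), hn, Nat.even_three_pow_sub_one_div_two_iff]
  constructor
  · rintro ⟨σ, hσA, hσ⟩
    rw [Equiv.Perm.mem_alternatingGroup, hsign σ hσ] at hσA
    exact hparity.1 hσA
  · intro hev
    have hcop : IsCoprime j (orderOf ρ : ℤ) := by
      obtain ⟨c, hc⟩ := hj.dvd
      rw [horder, Nat.cast_pow]
      exact IsCoprime.pow_right ⟨-1, -c, by push_cast; linarith⟩
    obtain ⟨σ, hσ⟩ := isConj_iff.1 (hcyc.isConj_zpow hcop)
    exact ⟨σ, Equiv.Perm.mem_alternatingGroup.2 ((hsign σ hσ).trans (hparity.2 hev)), hσ⟩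
end

section
/- Let n be a natural number. There exists a subgroup H of the alternating group A_n such that the group F(A_n, H) = (H ∩ [A_n, A_n]) / Φ^{A_n}(H) contains an element of order 3 (equivalently, by the classification of F(A_n,H), such that the 3-primary part of F(A_n,H) is isomorphic to ℤ/3ℤ) if and only if n ≥ 5 and n admits a representation n = 3^{r_1} + 3^{r_2} + ⋯ + 3^{r_k} with 0 ≤ r_1 < r_2 < ⋯ < r_k such that the number of indices i with r_i odd is odd. -/
set_option synthInstance.maxHeartbeats 1000000
set_option maxHeartbeats 1000000

section Reversal

open Equiv Equiv.Perm

theorem sign_revPerm_of_odd {m : ℕ} :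
    sign (Fin.revPerm : Perm (Fin (2 * m + 1))) = (-1) ^ m := by
  have hsupp : (Fin.revPerm : Perm (Fin (2 * m + 1))).support =
      Finset.univ.erase ⟨m, by omega⟩ := by
    ext i
    simp only [mem_support, Fin.revPerm_apply, Finset.mem_erase, Finset.mem_univ, and_true, ne_eq,
      Fin.ext_iff, Fin.val_rev]
    omega
  rw [sign_of_pow_two_eq_one (by ext i; simp [pow_two]), card_fixedPoints, sum_cycleType, hsupp,
    Finset.card_erase_of_mem (Finset.mem_univ _)]
  simp

theorem revPerm_conj_finRotate (n : ℕ) :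
    Fin.revPerm * finRotate n * Fin.revPerm⁻¹ = (finRotate n)⁻¹ := by
  rw [mul_inv_eq_iff_eq_mul, eq_inv_mul_iff_mul_eq]
  rcases n with _ | n
  · ext i; exact i.elim0
  · ext i
    simp [finRotate_apply, Fin.rev_add]

theorem exists_conj_eq_inv_of_isCycle {α : Type*} [Fintype α] [DecidableEq α] {σ : Perm α}
    (hσ : σ.IsCycle) (hodd : Odd σ.support.card) :
    ∃ g : Perm α, g * σ * g⁻¹ = σ⁻¹ ∧ sign g = (-1) ^ (σ.support.card / 2) ∧
      ∀ x, σ x = x → g x = x := by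
  have hc := hσ.two_le_card_support
  let f : Fin σ.support.card ≃ {x // x ∈ σ.support} := σ.support.equivFin.symm
  obtain ⟨h, hh⟩ : ∃ h, h * (finRotate σ.support.card).extendDomain f * h⁻¹ = σ := by
    rw [← isConj_iff, isConj_iff_cycleType_eq, cycleType_extendDomain,
      cycleType_finRotate_of_le hc, hσ.cycleType]
  refine ⟨h * Fin.revPerm.extendDomain f * h⁻¹, ?_, ?_, fun x hx => ?_⟩
  · have key : Fin.revPerm.extendDomain f * (finRotate σ.support.card).extendDomain f *
        (Fin.revPerm.extendDomain f)⁻¹ = ((finRotate σ.support.card).extendDomain f)⁻¹ := by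
      rw [extendDomain_inv, extendDomain_inv, extendDomain_mul, extendDomain_mul,
        revPerm_conj_finRotate]
    calc h * Fin.revPerm.extendDomain f * h⁻¹ * σ * (h * Fin.revPerm.extendDomain f * h⁻¹)⁻¹
        = h * Fin.revPerm.extendDomain f * h⁻¹ *
          (h * (finRotate σ.support.card).extendDomain f * h⁻¹) *
          (h * Fin.revPerm.extendDomain f * h⁻¹)⁻¹ := by rw [hh]
      _ = h * (Fin.revPerm.extendDomain f * (finRotate σ.support.card).extendDomain f *
        (Fin.revPerm.extendDomain f)⁻¹) * h⁻¹ := by group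
      _ = (h * (finRotate σ.support.card).extendDomain f * h⁻¹)⁻¹ := by rw [key]; group
      _ = σ⁻¹ := by rw [hh]
  · have h2 : ∀ c, Odd c → sign (Fin.revPerm : Perm (Fin c)) = (-1) ^ (c / 2) := by
      rintro _ ⟨m, rfl⟩
      rw [sign_revPerm_of_odd]; congr 1; omega
    rw [Perm.sign_mul, Perm.sign_mul, sign_inv, sign_extendDomain, h2 _ hodd, mul_comm, ← mul_assoc,
      Int.units_mul_self, one_mul]
  · have hfix : (finRotate σ.support.card).extendDomain f (h⁻¹ x) = h⁻¹ x := by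
      rw [← hh] at hx
      exact (Perm.eq_inv_iff_eq).2 hx
    have hx' : h⁻¹ x ∉ σ.support := by
      intro hmem
      obtain ⟨i, hi⟩ := f.surjective ⟨h⁻¹ x, hmem⟩
      have hi' : h⁻¹ x = f i := by rw [hi]
      rw [hi', extendDomain_apply_image, Subtype.coe_inj, f.apply_eq_iff_eq] at hfix
      have : i ∈ (finRotate σ.support.card).support := by
        rw [support_finRotate_of_le hc]; exact Finset.mem_univ _
      exact mem_support.1 this hfix
    rw [Perm.mul_apply, Perm.mul_apply, extendDomain_apply_not_subtype _ _ hx']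
    simp

theorem exists_conj_eq_inv {α : Type*} [Fintype α] [DecidableEq α] (σ : Perm α)
    (hodd : ∀ c ∈ σ.cycleType, Odd c) :
    ∃ g : Perm α, g * σ * g⁻¹ = σ⁻¹ ∧ sign g = (σ.cycleType.map fun c => (-1) ^ (c / 2)).prod ∧
      ∀ x, σ x = x → g x = x := by
  induction σ using cycle_induction_on with
  | base_one => exact ⟨1, by simp⟩
  | base_cycles σ hσ =>
    simp only [hσ.cycleType, Multiset.mem_singleton, forall_eq, Multiset.map_singleton,
      Multiset.prod_singleton] at hodd ⊢
    exact exists_conj_eq_inv_of_isCycle hσ hodd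
  | induction_disjoint σ τ hd hσ ihσ ihτ =>
    simp only [hd.cycleType_mul, Multiset.mem_add, Multiset.map_add, Multiset.prod_add] at hodd ⊢
    obtain ⟨g, hg, hgs, hgf⟩ := ihσ fun c hc => hodd c (Or.inl hc)
    obtain ⟨k, hk, hks, hkf⟩ := ihτ fun c hc => hodd c (Or.inr hc)
    have h1 : Commute g k := Disjoint.commute fun x => (hd x).imp (hgf x) (hkf x)
    have h2 : Commute k σ := Disjoint.commute fun x => (hd x).symm.imp (hkf x) id
    have h3 : Commute g τ := Disjoint.commute fun x => (hd x).imp (hgf x) id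
    refine ⟨g * k, ?_, by rw [Perm.sign_mul, hgs, hks], fun x hx => ?_⟩
    · rw [hd.commute.mul_inv, ← hg, ← hk]
      calc g * k * (σ * τ) * (g * k)⁻¹ = g * (k * σ) * (τ * k⁻¹) * g⁻¹ := by group
        _ = g * σ * (k * τ * k⁻¹) * g⁻¹ := by rw [h2.eq]; group
        _ = g * σ * τ⁻¹ * g⁻¹ := by rw [hk]
        _ = g * σ * g⁻¹ * τ⁻¹ := by
          rw [mul_assoc _ τ⁻¹, mul_assoc _ g⁻¹, h3.inv_inv.eq]
        _ = _ := by rw [hk]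
    · rw [hd.mul_apply_eq_iff] at hx
      rw [Perm.mul_apply, hkf x hx.2, hgf x hx.1]

theorem neg_one_pow_three_pow_div_two (r : ℕ) : (-1 : ℤˣ) ^ (3 ^ r / 2) = (-1) ^ r := by
  induction r with
  | zero => rfl
  | succ r ih =>
    have hodd : 3 ^ r % 2 = 1 := Nat.odd_iff.1 (Odd.pow (by decide))
    have h : 3 ^ (r + 1) / 2 = 2 * (3 ^ r / 2) + 3 ^ r / 2 + 1 := by omega
    rw [h, pow_succ, pow_add, pow_mul, ih, neg_one_sq, one_pow, one_mul, ← pow_succ]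

theorem prod_neg_one_pow_three_pow_div_two (S : Finset ℕ) :
    ((S.val.map fun s => 3 ^ s).map fun c => (-1 : ℤˣ) ^ (c / 2)).prod = (-1) ^ ∑ s ∈ S, s := by
  rw [Multiset.map_map, ← Finset.prod_pow_eq_pow_sum]
  exact Finset.prod_congr rfl fun s _ => neg_one_pow_three_pow_div_two s

theorem exists_finset_of_not_conj_inv {α : Type*} [Fintype α] [DecidableEq α] {σ : Perm α} {k : ℕ}
    (hk : σ ^ 3 ^ k = 1) (hno : ∀ g : Perm α, sign g = 1 → g * σ * g⁻¹ ≠ σ⁻¹) :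
    ∃ S : Finset ℕ, Fintype.card α = ∑ s ∈ S, 3 ^ s ∧ Odd (∑ s ∈ S, s) := by
  have hpow : ∀ c ∈ σ.cycleType, ∃ r, r ≠ 0 ∧ c = 3 ^ r := by
    intro c hc
    obtain ⟨r, -, rfl⟩ := (Nat.dvd_prime_pow Nat.prime_three).1
      ((dvd_of_mem_cycleType hc).trans (orderOf_dvd_of_pow_eq_one hk))
    refine ⟨r, ?_, rfl⟩
    rintro rfl
    exact absurd (two_le_of_mem_cycleType hc) (by norm_num)
  have hodd : ∀ c ∈ σ.cycleType, Odd c := by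
    intro c hc
    obtain ⟨r, -, rfl⟩ := hpow c hc
    exact Odd.pow (by decide)
  obtain ⟨g, hg, hgs, -⟩ := exists_conj_eq_inv σ hodd
  have hgn : sign g = -1 := (Int.units_eq_one_or _).resolve_left fun h => hno g h hg
  have hcent : Subgroup.centralizer {σ} ≤ alternatingGroup α := by
    intro z hz
    rw [Subgroup.mem_centralizer_singleton_iff] at hz
    by_contra hzn
    rw [mem_alternatingGroup] at hzn
    refine hno (g * z) ?_ ?_
    · rw [Perm.sign_mul, hgn, (Int.units_eq_one_or _).resolve_left hzn]; rfl
    · calc g * z * σ * (g * z)⁻¹ = g * (z * σ) * z⁻¹ * g⁻¹ := by group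
        _ = g * σ * g⁻¹ := by rw [hz]; group
        _ = σ⁻¹ := hg
  obtain ⟨-, hcard, hcount⟩ := centralizer_le_alternating_iff.1 hcent
  have hlog : ∀ c ∈ σ.cycleType, 3 ^ Nat.log 3 c = c := by
    intro c hc
    obtain ⟨r, -, rfl⟩ := hpow c hc
    rw [Nat.log_pow (by norm_num)]
  let T : Finset ℕ := ⟨σ.cycleType.map (Nat.log 3),
    (Multiset.nodup_iff_count_le_one.2 hcount).map_on fun a ha b hb h => by
      rw [← hlog a ha, ← hlog b hb, h]⟩
  have hT : σ.cycleType = T.val.map fun s => 3 ^ s := by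
    rw [show T.val = σ.cycleType.map (Nat.log 3) from rfl, Multiset.map_map]
    exact ((Multiset.map_congr rfl hlog).trans (Multiset.map_id' _)).symm
  have hT0 : 0 ∉ T := by
    intro h
    obtain ⟨c, hc, hc0⟩ := Multiset.mem_map.1 (Finset.mem_def.1 h)
    obtain ⟨r, hr, rfl⟩ := hpow c hc
    rw [Nat.log_pow (by norm_num)] at hc0
    exact hr hc0
  have hsum : σ.cycleType.sum = ∑ s ∈ T, 3 ^ s := by rw [hT]; rfl
  have hle := σ.sum_cycleType_le
  have hTodd : Odd (∑ s ∈ T, s) := by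
    rw [hT, prod_neg_one_pow_three_pow_div_two, hgn] at hgs
    by_contra h
    rw [(Nat.not_odd_iff_even.1 h).neg_one_pow] at hgs
    exact absurd hgs (by decide)
  rcases hle.eq_or_lt with h | h
  · exact ⟨T, by rw [← hsum, h], hTodd⟩
  · refine ⟨insert 0 T, ?_, ?_⟩
    · rw [Finset.sum_insert hT0, ← hsum]; omega
    · rwa [Finset.sum_insert hT0, zero_add]

theorem exists_not_conj_inv_of_finset {α : Type*} [Fintype α] [DecidableEq α] {S : Finset ℕ}
    (hS : Fintype.card α = ∑ s ∈ S, 3 ^ s) (hodd : Odd (∑ s ∈ S, s)) :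
    ∃ (σ : Perm α) (k : ℕ), sign σ = 1 ∧ σ ^ 3 ^ k = 1 ∧
      ∀ g : Perm α, sign g = 1 → g * σ * g⁻¹ ≠ σ⁻¹ := by
  let T := S.erase 0
  have hTsum : ∑ s ∈ T, s = ∑ s ∈ S, s := Finset.sum_erase S rfl
  have hTle : ∑ s ∈ T, 3 ^ s ≤ Fintype.card α := by
    rw [hS]; exact Finset.sum_le_sum_of_subset (Finset.erase_subset _ _)
  have hTge : Fintype.card α ≤ ∑ s ∈ T, 3 ^ s + 1 := by
    rw [hS]
    by_cases h0 : 0 ∈ S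
    · exact (Finset.sum_erase_add S (fun s => 3 ^ s) h0).ge
    · rw [show T = S from Finset.erase_eq_of_notMem h0]; omega
  obtain ⟨σ, hσ⟩ := (exists_with_cycleType_iff α (m := T.val.map fun s => 3 ^ s)).2
    ⟨hTle, fun a ha => by
      obtain ⟨s, hs, rfl⟩ := Multiset.mem_map.1 ha
      have h3 : 3 ^ 1 ≤ 3 ^ s := Nat.pow_le_pow_right (by norm_num)
        (Nat.one_le_iff_ne_zero.2 (Finset.ne_of_mem_erase (Finset.mem_def.2 hs)))
      omega⟩
  have hσodd : ∀ c ∈ σ.cycleType, Odd c := by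
    rw [hσ]
    intro c hc
    obtain ⟨s, -, rfl⟩ := Multiset.mem_map.1 hc
    exact Odd.pow (by decide)
  have hcent : Subgroup.centralizer {σ} ≤ alternatingGroup α := by
    refine centralizer_le_alternating_iff.2 ⟨hσodd, ?_, ?_⟩
    · rw [hσ]; exact hTge
    · rw [← Multiset.nodup_iff_count_le_one, hσ]
      exact T.nodup.map (Nat.pow_right_injective (by norm_num))
  obtain ⟨g, hg, hgs, -⟩ := exists_conj_eq_inv σ hσodd
  rw [hσ, prod_neg_one_pow_three_pow_div_two, hTsum, hodd.neg_one_pow] at hgs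
  refine ⟨σ, T.sup id, mem_alternatingGroup.1 (hcent (Subgroup.mem_centralizer_singleton_iff.2 rfl)),
    ?_, fun z hz hzσ => ?_⟩
  · rw [← orderOf_dvd_iff_pow_eq_one, ← lcm_cycleType, Multiset.lcm_dvd, hσ]
    intro c hc
    obtain ⟨s, hs, rfl⟩ := Multiset.mem_map.1 hc
    exact pow_dvd_pow 3 (Finset.le_sup (f := id) (Finset.mem_def.2 hs))
  · have hmem : z⁻¹ * g ∈ Subgroup.centralizer {σ} := by
      rw [Subgroup.mem_centralizer_singleton_iff]
      have h : g * σ * g⁻¹ = z * σ * z⁻¹ := hg.trans hzσ.symm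
      calc z⁻¹ * g * σ = z⁻¹ * (g * σ * g⁻¹) * g := by group
        _ = σ * (z⁻¹ * g) := by rw [h]; group
    have h := mem_alternatingGroup.1 (hcent hmem)
    rw [Perm.sign_mul, sign_inv, hz, hgs] at h
    exact absurd h (by decide)

end Reversal

section CyclicThreeGroup

variable {G : Type*} [Group G] {x g : G} {m : ℕ}

theorem inv_pow_conj_eq_zpow_pow {k : ℤ} (h : g⁻¹ * x * g = x ^ k) (j : ℕ) :
    (g ^ j)⁻¹ * x * g ^ j = x ^ k ^ j := by
  induction j with
  | zero => simp
  | succ j ih =>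
    calc (g ^ (j + 1))⁻¹ * x * g ^ (j + 1) = g⁻¹ * ((g ^ j)⁻¹ * x * g ^ j) * g⁻¹⁻¹ := by
          rw [pow_succ]; group
      _ = (g⁻¹ * x * g⁻¹⁻¹) ^ k ^ j := by rw [ih, conj_zpow]
      _ = x ^ k ^ (j + 1) := by rw [inv_inv, h, ← zpow_mul, ← pow_succ']

theorem three_dvd_sub_of_conj_zpow (hx : orderOf x = 3 ^ (m + 1))
    (hno : ∀ g : G, g⁻¹ * x * g ≠ x⁻¹) {a b : ℤ} (h : g⁻¹ * x ^ a * g = x ^ b) :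
    (3 : ℤ) ∣ b - a := by
  have hord : orderOf (x ^ a) = orderOf (x ^ b) := by
    rw [← h]
    have := MulAut.conj g⁻¹ |>.orderOf_eq (x ^ a)
    rwa [MulAut.conj_apply, inv_inv, eq_comm] at this
  have hiff : ∀ c : ℤ, (3 : ℤ) ∣ c ↔ (x ^ c) ^ 3 ^ m = 1 := by
    intro c
    rw [← zpow_natCast, ← zpow_mul, ← orderOf_dvd_iff_zpow_eq_one, hx]
    push_cast
    rw [pow_succ', mul_dvd_mul_iff_right (by positivity)]
  have hab : (3 : ℤ) ∣ a ↔ (3 : ℤ) ∣ b := by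
    rw [hiff, hiff, ← orderOf_dvd_iff_pow_eq_one, hord, orderOf_dvd_iff_pow_eq_one]
  by_cases ha : (3 : ℤ) ∣ a
  · exact dvd_sub (hab.1 ha) ha
  by_contra hba
  have hb : ¬ (3 : ℤ) ∣ b := fun h => ha (hab.2 h)
  have hcop : IsCoprime a ((3 : ℤ) ^ (m + 1)) :=
    (((Int.prime_three.coprime_iff_not_dvd).2 ha).symm).pow_right
  obtain ⟨u, v, huv⟩ := hcop
  have hxu : (x ^ a) ^ u = x := by
    rw [← zpow_mul, mul_comm, show u * a = 1 - v * 3 ^ (m + 1) by linarith, zpow_sub, zpow_one,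
      mul_comm v, zpow_mul]
    have : x ^ ((3 : ℤ) ^ (m + 1)) = 1 := by
      rw [← orderOf_dvd_iff_zpow_eq_one, hx]; push_cast; rfl
    rw [this]; simp
  have hk : g⁻¹ * x * g = x ^ (b * u) := by
    rw [zpow_mul, ← h]
    have := conj_zpow (i := u) (a := g⁻¹) (b := x ^ a)
    rw [inv_inv] at this
    rw [this, hxu]
  have hbu : (3 : ℤ) ∣ b * u - -1 := by
    have h1 : (3 : ℤ) ∣ u * a - 1 := by
      rw [show u * a - 1 = 3 * (-(v * 3 ^ m)) by rw [pow_succ] at huv; linarith]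
      exact dvd_mul_right _ _
    have h2 : (3 : ℤ) ∣ b + a := by
      have ha' : a % 3 = 1 ∨ a % 3 = 2 := by omega
      have hb' : b % 3 = 1 ∨ b % 3 = 2 := by omega
      rcases ha' with ha' | ha' <;> rcases hb' with hb' | hb' <;> omega
    rw [show b * u - -1 = u * (b + a) - (u * a - 1) by ring]
    exact dvd_sub (dvd_mul_of_dvd_right h2 _) h1
  refine hno (g ^ 3 ^ m) ?_
  have h3 := dvd_sub_pow_of_dvd_sub (p := 3) hbu m
  rw [Odd.neg_one_pow (Odd.pow (by decide))] at h3
  rw [inv_pow_conj_eq_zpow_pow hk, ← zpow_neg_one, zpow_eq_zpow_iff_modEq, hx]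
  refine (Int.modEq_iff_dvd.2 ?_).symm
  push_cast at h3 ⊢
  exact h3

theorem notMem_focal_zpowers (hx : orderOf x = 3 ^ (m + 1))
    (hno : ∀ g : G, g⁻¹ * x * g ≠ x⁻¹) : x ∉ focal (Subgroup.zpowers x) := by
  have hle : focal (Subgroup.zpowers x) ≤ Subgroup.zpowers (x ^ 3) := by
    rw [focal, Subgroup.closure_le]
    rintro _ ⟨_, ⟨a, rfl⟩, g, ⟨b, hb⟩, rfl⟩
    dsimp only at hb ⊢
    obtain ⟨c, hc⟩ := three_dvd_sub_of_conj_zpow hx hno hb.symm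
    refine ⟨c, ?_⟩
    dsimp only
    rw [← hb, ← zpow_neg, ← zpow_add, ← zpow_natCast, ← zpow_mul]
    congr 1
    push_cast
    omega
  intro hmem
  obtain ⟨c, hc⟩ := hle hmem
  dsimp only at hc
  rw [← zpow_natCast, ← zpow_mul] at hc
  have h1 : x ^ (((3 : ℕ) : ℤ) * c - 1) = 1 := by rw [zpow_sub, hc, zpow_one, mul_inv_cancel]
  rw [← orderOf_dvd_iff_zpow_eq_one, hx] at h1
  have h3 : (3 : ℤ) ∣ 3 * c - 1 := by
    push_cast at h1
    exact (dvd_pow_self 3 (Nat.succ_ne_zero m)).trans h1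
  omega

theorem exists_orderOf_eq_three {k : ℕ} (hk : x ^ 3 ^ k = 1) (hx : x ≠ 1) :
    ∃ y : G, orderOf y = 3 := by
  obtain ⟨j, -, hj⟩ := (Nat.dvd_prime_pow Nat.prime_three).1 (orderOf_dvd_of_pow_eq_one hk)
  rcases j with _ | j
  · exact absurd (orderOf_eq_one_iff.1 hj) hx
  · exact ⟨x ^ 3 ^ j, by
      rw [orderOf_pow_of_dvd (by positivity) (hj ▸ pow_dvd_pow 3 j.le_succ), hj, pow_succ,
        Nat.mul_div_cancel_left _ (by positivity)]⟩

/-- An element of `3`-power order generates a subgroup with nontrivial `3`-part of `F(G,H)` if it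
is not conjugate to its inverse. -/
theorem exists_orderOf_three_FGroup_zpowers (hG : commutator G = ⊤) {k : ℕ} (hk : x ^ 3 ^ k = 1)
    (hno : ∀ g : G, g⁻¹ * x * g ≠ x⁻¹) :
    ∃ y : FGroup (Subgroup.zpowers x), orderOf y = 3 := by
  obtain ⟨j, -, hj⟩ := (Nat.dvd_prime_pow Nat.prime_three).1 (orderOf_dvd_of_pow_eq_one hk)
  rcases j with _ | m
  · have h1 : x = 1 := orderOf_eq_one_iff.1 hj
    exact absurd (by simp [h1]) (hno 1)
  let x' : ↥(Subgroup.zpowers x ⊓ commutator G) :=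
    ⟨x, Subgroup.mem_zpowers x, hG ▸ Subgroup.mem_top x⟩
  refine exists_orderOf_eq_three (x := (QuotientGroup.mk x' : FGroup (Subgroup.zpowers x)))
    (k := k) ?_ ?_
  · rw [← QuotientGroup.mk_pow, show x' ^ 3 ^ k = 1 from Subtype.ext hk, QuotientGroup.mk_one]
  · rw [ne_eq, QuotientGroup.eq_one_iff, Subgroup.mem_subgroupOf]
    exact notMem_focal_zpowers hj hno

/-- An element of order `3` of `F(G,H)` lifts to an element of `3`-power order of `H` which is not
conjugate to its inverse. -/
theorem exists_not_conj_inv_of_FGroup [Finite G] {H : Subgroup G} {y : FGroup H}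
    (hy : orderOf y = 3) :
    ∃ (x : G) (k : ℕ), x ∈ commutator G ∧ x ^ 3 ^ k = 1 ∧ ∀ g : G, g⁻¹ * x * g ≠ x⁻¹ := by
  obtain ⟨h, rfl⟩ := QuotientGroup.mk_surjective y
  obtain ⟨k, t, ht, hkt⟩ := Nat.exists_eq_pow_mul_and_not_dvd (orderOf_pos h).ne' 3 (by norm_num)
  have hx1 : (h ^ t) ^ 3 ^ k = 1 := by rw [← pow_mul, mul_comm, ← hkt, pow_orderOf_eq_one]
  have hxG : ((h ^ t : ↥(H ⊓ commutator G)) : G) ^ 3 ^ k = 1 := by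
    rw [← Subgroup.coe_pow, hx1, Subgroup.coe_one]
  refine ⟨(h ^ t : ↥(H ⊓ commutator G)), k, (h ^ t).2.2, hxG, fun g hg => ht ?_⟩
  rw [← hy, orderOf_dvd_iff_pow_eq_one, ← QuotientGroup.mk_pow, QuotientGroup.eq_one_iff,
    Subgroup.mem_subgroupOf]
  set x : G := ((h ^ t : ↥(H ⊓ commutator G)) : G) with hxdef
  have hxH : x ∈ H := (h ^ t).2.1
  have hsq : x⁻¹ * x⁻¹ ∈ focal H :=
    Subgroup.subset_closure ⟨x, hxH, g, hg ▸ H.inv_mem hxH, by rw [hg]⟩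
  have hsq' : x ^ 2 ∈ focal H := by
    rw [pow_two, ← inv_inv (x * x), mul_inv_rev]; exact (focal H).inv_mem hsq
  obtain ⟨q, hq⟩ : Odd (3 ^ k) := Odd.pow (by decide)
  have hx : x = (x ^ 2) ^ (q + 1) := by
    rw [← pow_mul, show 2 * (q + 1) = 3 ^ k + 1 by omega, pow_succ, hxG, one_mul]
  rw [hx]
  exact (focal H).pow_mem hsq' _

end CyclicThreeGroup

theorem eq_one_of_mem_commutator_alternatingGroup_of_pow_three {n k : ℕ} (hn : n ≤ 4)
    {x : alternatingGroup (Fin n)} (hx : x ∈ commutator (alternatingGroup (Fin n)))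
    (hk : x ^ 3 ^ k = 1) : x = 1 := by
  rcases hn.eq_or_lt with rfl | hn
  · rw [← alternatingGroup.kleinFour_eq_commutator (by simp)] at hx
    have h2 : x ^ 2 = 1 := by
      have h := Monoid.pow_exponent_eq_one
        (⟨x, hx⟩ : alternatingGroup.kleinFour (Fin 4))
      rw [alternatingGroup.exponent_kleinFour_of_card_eq_four (by simp)] at h
      exact congrArg Subtype.val h
    have hcop : Nat.Coprime 2 (3 ^ k) := Nat.Coprime.pow_right k (by norm_num)
    exact orderOf_eq_one_iff.1 (Nat.dvd_one.1 (hcop ▸ Nat.dvd_gcd (orderOf_dvd_of_pow_eq_one h2)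
      (orderOf_dvd_of_pow_eq_one hk)))
  · have := alternatingGroup.isMulCommutative_of_card_le_three (α := Fin n) (by simp; omega)
    rwa [commutator_eq_bot, Subgroup.mem_bot] at hx

theorem exists_strictMono_iff_exists_finset (n : ℕ) :
    (∃ (k : ℕ) (r : Fin k → ℕ), StrictMono r ∧ n = ∑ i, 3 ^ (r i) ∧
      Odd (Finset.univ.filter fun i => Odd (r i)).card) ↔
    ∃ S : Finset ℕ, n = ∑ s ∈ S, 3 ^ s ∧ Odd (∑ s ∈ S, s) := by
  constructor
  · rintro ⟨k, r, hr, hn, hodd⟩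
    refine ⟨Finset.univ.map ⟨r, hr.injective⟩, ?_, ?_⟩
    · rw [Finset.sum_map]; exact hn
    · rw [Finset.sum_map]
      exact (Finset.odd_sum_iff_odd_card_odd r).2 hodd
  · rintro ⟨S, hn, hodd⟩
    have hS := S.map_orderEmbOfFin_univ rfl
    refine ⟨S.card, S.orderEmbOfFin rfl, (S.orderEmbOfFin rfl).strictMono, ?_, ?_⟩
    · conv_lhs => rw [hn, ← hS, Finset.sum_map]
      rfl
    · rw [← Finset.odd_sum_iff_odd_card_odd]
      rw [← hS, Finset.sum_map] at hodd
      exact hodd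

/-- There exists a subgroup `H ≤ Aₙ` such that
`F(Aₙ, H) = (H ∩ [Aₙ, Aₙ]) / Φ^{Aₙ}(H)` contains an element of order 3 if and only if
`n ≥ 5` and `n = 3^{r₁} + ⋯ + 3^{r_k}` with `0 ≤ r₁ < ⋯ < r_k` such that the number of
indices `i` with `r i` odd is odd. -/
theorem exists_order_three_in_FGroup_iff (n : ℕ) :
    (∃ (H : Subgroup ↥(alternatingGroup (Fin n))) (x : FGroup H), orderOf x = 3) ↔
    (5 ≤ n ∧ ∃ (k : ℕ) (r : Fin k → ℕ), StrictMono r ∧ n = ∑ i, 3 ^ (r i) ∧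
      Odd (Finset.univ.filter fun i => Odd (r i)).card) := by
  rw [exists_strictMono_iff_exists_finset]
  constructor
  · rintro ⟨H, y, hy⟩
    obtain ⟨x, k, hxc, hk, hno⟩ := exists_not_conj_inv_of_FGroup hy
    refine ⟨?_, ?_⟩
    · by_contra hn
      have hx1 := eq_one_of_mem_commutator_alternatingGroup_of_pow_three (by omega) hxc hk
      exact hno 1 (by simp [hx1])
    · obtain ⟨S, hS⟩ := exists_finset_of_not_conj_inv (σ := (x : Equiv.Perm (Fin n)))
        (congrArg Subtype.val hk) fun g hg hgx =>
          hno ⟨g, Equiv.Perm.mem_alternatingGroup.2 hg⟩⁻¹ (Subtype.ext (by simpa using hgx))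
      exact ⟨S, by simpa using hS⟩
  · rintro ⟨hn, S, hS, hodd⟩
    obtain ⟨σ, k, hσ, hk, hno⟩ :=
      exists_not_conj_inv_of_finset (α := Fin n) (by simpa using hS) hodd
    refine ⟨_, exists_orderOf_three_FGroup_zpowers
      (x := (⟨σ, Equiv.Perm.mem_alternatingGroup.2 hσ⟩ : alternatingGroup (Fin n)))
      (commutator_alternatingGroup_eq_top (by simpa using hn)) (Subtype.ext hk) fun g hg =>
        hno (g : Equiv.Perm (Fin n))⁻¹ ?_ ?_⟩
    · rw [Equiv.Perm.sign_inv]; exact Equiv.Perm.mem_alternatingGroup.1 g.2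
    · simpa using congrArg Subtype.val hg
end

section
/- Let λ : Ḡ → G be a surjective group homomorphism, let H be a subgroup of G, and let H̄ = λ⁻¹(H) be its preimage. Then λ(H̄ ∩ [Ḡ,Ḡ]) = H ∩ [G,G] and λ(Φ^{Ḡ}(H̄)) = Φ^{G}(H), so λ induces a surjective homomorphism F(Ḡ, H̄) → F(G, H); moreover this induced homomorphism is an isomorphism if and only if ker λ ∩ [Ḡ,Ḡ] is contained in Φ^{Ḡ}(H̄). -/
set_option synthInstance.maxHeartbeats 1000000
set_option maxHeartbeats 1000000

open scoped commutatorElement in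
theorem focal_le_inf_commutator {G : Type*} [Group G] (H : Subgroup G) :
    focal H ≤ H ⊓ commutator G := by
  refine (Subgroup.closure_le _).2 ?_
  rintro _ ⟨h, hh, g, hg, rfl⟩
  refine ⟨H.mul_mem (H.inv_mem hh) hg, ?_⟩
  have hcomm : h⁻¹ * (g⁻¹ * h * g) = ⁅h⁻¹, g⁻¹⁆ := by
    simp only [commutatorElement_def]
    group
  rw [hcomm]
  exact Subgroup.commutator_mem_commutator (Subgroup.mem_top _) (Subgroup.mem_top _)

theorem map_commutator_of_surjective {K G : Type*} [Group K] [Group G]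
    {f : K →* G} (hf : Function.Surjective f) : (commutator K).map f = commutator G := by
  rw [commutator_def, commutator_def, Subgroup.map_commutator,
    Subgroup.map_top_of_surjective f hf]

theorem map_comap_inf_commutator {K G : Type*} [Group K] [Group G]
    {f : K →* G} (hf : Function.Surjective f) (H : Subgroup G) :
    (H.comap f ⊓ commutator K).map f = H ⊓ commutator G := by
  rw [← map_commutator_of_surjective hf]
  ext y
  constructor
  · rintro ⟨x, ⟨hxH, hxc⟩, rfl⟩
    exact ⟨hxH, x, hxc, rfl⟩
  · rintro ⟨hyH, x, hxc, rfl⟩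
    exact ⟨x, ⟨hyH, hxc⟩, rfl⟩

theorem image_focalSet_comap {K G : Type*} [Group K] [Group G]
    {f : K →* G} (hf : Function.Surjective f) (H : Subgroup G) :
    f '' focalSet (H.comap f) = focalSet H := by
  ext y
  constructor
  · rintro ⟨_, ⟨h, hh, g, hg, rfl⟩, rfl⟩
    exact ⟨f h, hh, f g, by simpa using hg, by simp⟩
  · rintro ⟨h, hh, g, hg, rfl⟩
    obtain ⟨h, rfl⟩ := hf h
    obtain ⟨g, rfl⟩ := hf g
    exact ⟨h⁻¹ * (g⁻¹ * h * g), ⟨h, hh, g, by simpa using hg, rfl⟩, by simp⟩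

theorem map_focal_comap {K G : Type*} [Group K] [Group G]
    {f : K →* G} (hf : Function.Surjective f) (H : Subgroup G) :
    (focal (H.comap f)).map f = focal H := by
  rw [focal, focal, MonoidHom.map_closure, image_focalSet_comap hf]

/-- Let `λ : Ḡ → G` be a surjective group homomorphism, `H ≤ G`, and
`H̄ = λ⁻¹(H)`. Then `λ(H̄ ∩ [Ḡ,Ḡ]) = H ∩ [G,G]` and `λ(Φ^Ḡ(H̄)) = Φ^G(H)`, so `λ` induces a
surjective homomorphism `F(Ḡ, H̄) → F(G, H)`; moreover this induced homomorphism is an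
isomorphism if and only if `ker λ ∩ [Ḡ,Ḡ] ≤ Φ^Ḡ(H̄)`. -/
theorem FGroup_map_of_surjective {Gbar G : Type*} [Group Gbar] [Group G]
    (lam : Gbar →* G) (hsurj : Function.Surjective lam) (H : Subgroup G) :
    ((H.comap lam ⊓ commutator Gbar).map lam = H ⊓ commutator G) ∧
    ((focal (H.comap lam)).map lam = focal H) ∧
    ∃ f : FGroup (H.comap lam) →* FGroup H,
      Function.Surjective f ∧
      (∀ (x : ↥(H.comap lam ⊓ commutator Gbar)) (hx : lam ↑x ∈ H ⊓ commutator G),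
        f (QuotientGroup.mk x) = QuotientGroup.mk ⟨lam ↑x, hx⟩) ∧
      (Function.Bijective f ↔ lam.ker ⊓ commutator Gbar ≤ focal (H.comap lam)) := by
  have hinf := map_comap_inf_commutator hsurj H
  have hfocal := map_focal_comap hsurj H
  have hmem (x : ↥(H.comap lam ⊓ commutator Gbar)) : lam ↑x ∈ H ⊓ commutator G :=
    hinf ▸ Subgroup.mem_map_of_mem lam x.2
  let φ : ↥(H.comap lam ⊓ commutator Gbar) →* ↥(H ⊓ commutator G) :=
    (lam.comp (Subgroup.subtype _)).codRestrict _ hmem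
  have hφ : (focal (H.comap lam)).subgroupOf (H.comap lam ⊓ commutator Gbar) ≤
      ((focal H).subgroupOf (H ⊓ commutator G)).comap φ := fun x hx =>
    show lam ↑x ∈ focal H from hfocal ▸ Subgroup.mem_map_of_mem lam hx
  let f : FGroup (H.comap lam) →* FGroup H := QuotientGroup.map _ _ φ hφ
  have hf : Function.Surjective f := by
    intro y
    obtain ⟨⟨y, hy⟩, rfl⟩ := QuotientGroup.mk_surjective y
    have hym := hy
    rw [← hinf] at hym
    obtain ⟨x, hx, rfl⟩ := hym
    exact ⟨QuotientGroup.mk ⟨x, hx⟩, rfl⟩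
  refine ⟨hinf, hfocal, f, hf, fun _ _ => rfl, fun hbij x hx => ?_, fun hker => ⟨?_, hf⟩⟩
  · have hx1 : lam x = 1 := hx.1
    have hxH : x ∈ H.comap lam := by
      rw [Subgroup.mem_comap, hx1]
      exact H.one_mem
    let z : ↥(H.comap lam ⊓ commutator Gbar) := ⟨x, hxH, hx.2⟩
    have hfx : f (QuotientGroup.mk z) = 1 := by
      refine (QuotientGroup.eq_one_iff (φ z)).2 ?_
      change lam x ∈ focal H
      rw [hx1]
      exact (focal H).one_mem
    have hmk := hbij.1 (hfx.trans (map_one f).symm)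
    exact (QuotientGroup.eq_one_iff z).1 hmk
  · rw [injective_iff_map_eq_one]
    intro q hq
    obtain ⟨x, rfl⟩ := QuotientGroup.mk_surjective q
    have hx : lam ↑x ∈ focal H := (QuotientGroup.eq_one_iff (φ x)).1 hq
    rw [← hfocal] at hx
    obtain ⟨y, hy, hyx⟩ := hx
    have hxy : (x : Gbar) * y⁻¹ ∈ focal (H.comap lam) := by
      refine hker ⟨?_, (commutator Gbar).mul_mem x.2.2
        ((commutator Gbar).inv_mem (focal_le_inf_commutator _ hy).2)⟩
      change lam (↑x * y⁻¹) = 1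
      rw [map_mul, map_inv, hyx, mul_inv_cancel]
    refine (QuotientGroup.eq_one_iff x).2 ?_
    rw [Subgroup.mem_subgroupOf]
    simpa using mul_mem hxy hy
end

section
/- Let n ≥ 4, let U_n be the presented group defined below with distinguished central element z, and let λ : U_n → S_n be the homomorphism with λ(tᵢ) = (i, i+1) and λ(z) = 1. Let H be a subgroup of S_n of even order. Then z lies in the focal subgroup Φ^{U_n}(λ⁻¹(H)). Moreover, if H ≤ A_n, then z lies in the focal subgroup Φ^{V}(λ⁻¹(H)), where V = λ⁻¹(A_n) ≤ U_n. -/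
/-- The free-group generator `z` of Schur's presentation. -/
def zgen (n : ℕ) : FreeGroup (Unit ⊕ Fin (n - 1)) := FreeGroup.of (Sum.inl ())

/-- The free-group generator `tᵢ` (for `i = 1, …, n-1`, zero-indexed) of Schur's
presentation. -/
def tgen (n : ℕ) (i : Fin (n - 1)) : FreeGroup (Unit ⊕ Fin (n - 1)) :=
  FreeGroup.of (Sum.inr i)

/-- The relators of Schur's presentation of a generalized representation group `Uₙ` of `Sₙ`:
`z² = 1`; `z tᵢ = tᵢ z`; `tᵢ² = z`; `(tᵢ t_{i+1})³ = z`; and `tᵢ tⱼ = z tⱼ tᵢ` for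
`|i - j| ≥ 2`. -/
def schurRels (n : ℕ) : Set (FreeGroup (Unit ⊕ Fin (n - 1))) :=
  {r | r = zgen n ^ 2
    ∨ (∃ i, r = zgen n * tgen n i * (zgen n)⁻¹ * (tgen n i)⁻¹)
    ∨ (∃ i, r = tgen n i ^ 2 * (zgen n)⁻¹)
    ∨ (∃ i j : Fin (n - 1), (i : ℕ) + 1 = (j : ℕ) ∧ r = (tgen n i * tgen n j) ^ 3 * (zgen n)⁻¹)
    ∨ (∃ i j : Fin (n - 1), ((i : ℕ) + 2 ≤ (j : ℕ) ∨ (j : ℕ) + 2 ≤ (i : ℕ)) ∧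
        r = tgen n i * tgen n j * (zgen n * tgen n j * tgen n i)⁻¹)}

/-- Schur's generalized representation group `Uₙ` of `Sₙ`, given by the presentation
`schurRels n`. -/
abbrev SchurCover (n : ℕ) := PresentedGroup (schurRels n)

/-- The distinguished central element `z` of `Uₙ`. -/
def zU (n : ℕ) : SchurCover n := PresentedGroup.of (Sum.inl ())

/-- The generator `tᵢ` of `Uₙ` (zero-indexed). -/
def tU (n : ℕ) (i : Fin (n - 1)) : SchurCover n := PresentedGroup.of (Sum.inr i)

/-- The transposition `(i, i+1)` of `Sₙ` (zero-indexed). -/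
def transpo (n : ℕ) (i : Fin (n - 1)) : Equiv.Perm (Fin n) :=
  Equiv.swap ⟨i.1, by have := i.2; omega⟩ ⟨i.1 + 1, by have := i.2; omega⟩

/-- The focal subgroup `Φ^A(H)` of `H` relative to an ambient subgroup `A` (both subgroups of
a common group `G`): it is generated by the elements `h₁⁻¹h₂` with `h₁, h₂ ∈ H` such that
`h₂ = g⁻¹h₁g` for some `g ∈ A`. -/
def focalIn {G : Type*} [Group G] (A H : Subgroup G) : Subgroup G :=
  Subgroup.closure
    {x : G | ∃ h ∈ H, ∃ g ∈ A, g⁻¹ * h * g ∈ H ∧ x = h⁻¹ * (g⁻¹ * h * g)}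

open Equiv Equiv.Perm

/-- The generator `tᵢ` of `Uₙ` indexed by natural numbers, with value `1` out of range. -/
def tNat (n i : ℕ) : SchurCover n := if h : i < n - 1 then tU n ⟨i, h⟩ else 1

lemma tNat_of_lt {n i : ℕ} (h : i < n - 1) : tNat n i = tU n ⟨i, h⟩ := dif_pos h

/-- The lift `t₀ t₂ ⋯ t_{2(k-1)}` of a product of `k` disjoint transpositions. -/
def evenProd (n : ℕ) : ℕ → SchurCover n
  | 0 => 1
  | k + 1 => evenProd n k * tNat n (2 * k)

/-- The lift `t₁ t₀ t₂ t₁` of the double transposition `(0 2)(1 3)`. -/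
def doubleSwap (n : ℕ) : SchurCover n := tNat n 1 * tNat n 0 * tNat n 2 * tNat n 1

section Relations

variable {n : ℕ}

lemma zU_mul_self : zU n * zU n = 1 := by
  have h : PresentedGroup.mk (schurRels n) (zgen n ^ 2) = 1 :=
    PresentedGroup.one_of_mem (Or.inl rfl)
  rw [map_pow, pow_two] at h
  exact h

lemma zU_mul_tU (i : Fin (n - 1)) : zU n * tU n i = tU n i * zU n := by
  have h : PresentedGroup.mk (schurRels n) (zgen n * tgen n i * (zgen n)⁻¹ * (tgen n i)⁻¹) = 1 :=
    PresentedGroup.one_of_mem (Or.inr (Or.inl ⟨i, rfl⟩))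
  simp only [map_mul, map_inv] at h
  exact mul_inv_eq_iff_eq_mul.mp (mul_inv_eq_one.mp h)

lemma tU_mul_self (i : Fin (n - 1)) : tU n i * tU n i = zU n := by
  have h : PresentedGroup.mk (schurRels n) (tgen n i ^ 2 * (zgen n)⁻¹) = 1 :=
    PresentedGroup.one_of_mem (Or.inr (Or.inr (Or.inl ⟨i, rfl⟩)))
  simp only [map_mul, map_inv, map_pow] at h
  rw [← pow_two]
  exact mul_inv_eq_one.mp h

lemma tU_mul_pow_three {i j : Fin (n - 1)} (hij : (i : ℕ) + 1 = j) :
    (tU n i * tU n j) ^ 3 = zU n := by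
  have h : PresentedGroup.mk (schurRels n) ((tgen n i * tgen n j) ^ 3 * (zgen n)⁻¹) = 1 :=
    PresentedGroup.one_of_mem (Or.inr (Or.inr (Or.inr (Or.inl ⟨i, j, hij, rfl⟩))))
  simp only [map_mul, map_inv, map_pow] at h
  exact mul_inv_eq_one.mp h

lemma tU_mul_tU_of_far {i j : Fin (n - 1)} (hij : (i : ℕ) + 2 ≤ j ∨ (j : ℕ) + 2 ≤ i) :
    tU n i * tU n j = zU n * tU n j * tU n i := by
  have h : PresentedGroup.mk (schurRels n)
      (tgen n i * tgen n j * (zgen n * tgen n j * tgen n i)⁻¹) = 1 :=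
    PresentedGroup.one_of_mem (Or.inr (Or.inr (Or.inr (Or.inr ⟨i, j, hij, rfl⟩))))
  simp only [map_mul, map_inv] at h
  exact mul_inv_eq_one.mp h

lemma zU_mul_tNat (i : ℕ) : zU n * tNat n i = tNat n i * zU n := by
  unfold tNat
  split_ifs
  · exact zU_mul_tU _
  · simp

lemma tNat_mul_tNat_of_far {i j : ℕ} (hi : i < n - 1) (hj : j < n - 1)
    (hij : i + 2 ≤ j ∨ j + 2 ≤ i) :
    tNat n i * tNat n j = zU n * (tNat n j * tNat n i) := by
  rw [tNat_of_lt hi, tNat_of_lt hj, ← mul_assoc]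
  exact tU_mul_tU_of_far hij

/-- A pair of elements subject to Schur's relations satisfies the braid relation. -/
lemma braid_of_pow_three {G : Type*} [Group G] {z a b : G} (hz : z * z = 1)
    (ha : a * a = z) (hb : b * b = z) (hza : z * a = a * z) (hzb : z * b = b * z)
    (hab : (a * b) ^ 3 = z) : a * b * a = b * a * b := by
  have hz' : z⁻¹ = z := inv_eq_of_mul_eq_one_left hz
  have ha' : a⁻¹ = z * a := by
    rw [inv_eq_iff_mul_eq_one, hza, ← mul_assoc, ha, hz]
  have hb' : b⁻¹ = z * b := by
    rw [inv_eq_iff_mul_eq_one, hzb, ← mul_assoc, hb, hz]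
  have h1 : a * b * a = z * (b * a * b)⁻¹ := by
    rw [eq_mul_inv_iff_mul_eq, ← hab]
    simp only [pow_succ, pow_zero, one_mul, mul_assoc]
  have h2 : (b * a * b)⁻¹ = z * (b * a * b) := by
    simp only [mul_inv_rev, ha', hb']
    calc z * b * (z * a * (z * b)) = z * (b * z) * (a * z) * b := by simp only [mul_assoc]
      _ = (z * z) * b * (z * a) * b := by rw [← hzb, ← hza]; simp only [mul_assoc]
      _ = b * z * a * b := by rw [hz]; simp only [mul_assoc, one_mul]
      _ = z * (b * a * b) := by rw [← hzb]; simp only [mul_assoc]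
  rw [h1, h2, ← mul_assoc, hz, one_mul]

lemma tNat_braid {i : ℕ} (hi : i + 1 < n - 1) :
    tNat n i * tNat n (i + 1) * tNat n i = tNat n (i + 1) * tNat n i * tNat n (i + 1) := by
  rw [tNat_of_lt hi, tNat_of_lt (by omega : i < n - 1)]
  exact braid_of_pow_three zU_mul_self (tU_mul_self _) (tU_mul_self _) (zU_mul_tU _)
    (zU_mul_tU _) (tU_mul_pow_three rfl)

lemma tNat_zero_mul_doubleSwap (hn : 4 ≤ n) :
    tNat n 0 * doubleSwap n = doubleSwap n * tNat n 2 := by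
  have h01 := tNat_braid (n := n) (i := 0) (by omega)
  have h12 := tNat_braid (n := n) (i := 1) (by omega)
  norm_num at h01 h12
  unfold doubleSwap
  calc _ = (tNat n 0 * tNat n 1 * tNat n 0) * tNat n 2 * tNat n 1 := by simp only [mul_assoc]
    _ = tNat n 1 * tNat n 0 * (tNat n 1 * tNat n 2 * tNat n 1) := by
      rw [h01]; simp only [mul_assoc]
    _ = _ := by rw [h12]; simp only [mul_assoc]

lemma tNat_two_mul_doubleSwap (hn : 4 ≤ n) :
    tNat n 2 * doubleSwap n = doubleSwap n * tNat n 0 := by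
  have h01 := tNat_braid (n := n) (i := 0) (by omega)
  have h12 := tNat_braid (n := n) (i := 1) (by omega)
  have h02 := tNat_mul_tNat_of_far (n := n) (i := 0) (j := 2) (by omega) (by omega) (by omega)
  norm_num at h01 h12
  have h : doubleSwap n = zU n * (tNat n 1 * tNat n 2 * tNat n 0 * tNat n 1) := by
    unfold doubleSwap
    calc _ = tNat n 1 * (tNat n 0 * tNat n 2) * tNat n 1 := by simp only [mul_assoc]
      _ = (tNat n 1 * zU n) * tNat n 2 * tNat n 0 * tNat n 1 := by
        rw [h02]; simp only [mul_assoc]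
      _ = _ := by rw [← zU_mul_tNat]; simp only [mul_assoc]
  calc _ = (tNat n 2 * zU n) * (tNat n 1 * tNat n 2 * tNat n 0 * tNat n 1) := by
        rw [h]; simp only [mul_assoc]
    _ = zU n * ((tNat n 2 * tNat n 1 * tNat n 2) * tNat n 0 * tNat n 1) := by
        rw [← zU_mul_tNat]; simp only [mul_assoc]
    _ = zU n * (tNat n 1 * tNat n 2 * (tNat n 1 * tNat n 0 * tNat n 1)) := by
        rw [← h12]; simp only [mul_assoc]
    _ = _ := by rw [← h01, h]; simp only [mul_assoc]

lemma commute_mul_of_anticommute {G : Type*} [Group G] {z t a b : G} (hz : z * z = 1)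
    (hza : z * a = a * z) (ha : t * a = z * (a * t)) (hb : t * b = z * (b * t)) :
    Commute t (a * b) := by
  calc t * (a * b) = (t * a) * b := by rw [mul_assoc]
    _ = z * a * (t * b) := by rw [ha]; simp only [mul_assoc]
    _ = z * (a * z) * b * t := by rw [hb]; simp only [mul_assoc]
    _ = (z * z) * a * b * t := by rw [← hza]; simp only [mul_assoc]
    _ = a * b * t := by rw [hz, one_mul]

lemma commute_tNat_doubleSwap {j : ℕ} (hj : j < n - 1) (h4 : 4 ≤ j) :
    Commute (tNat n j) (doubleSwap n) := by
  have h (i : ℕ) (hi : i ≤ 2) : tNat n j * tNat n i = zU n * (tNat n i * tNat n j) :=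
    tNat_mul_tNat_of_far hj (by omega) (by omega)
  have h1 := commute_mul_of_anticommute zU_mul_self (zU_mul_tNat 1) (h 1 (by omega))
    (h 0 (by omega))
  have h2 := commute_mul_of_anticommute zU_mul_self (zU_mul_tNat 2) (h 2 le_rfl)
    (h 1 (by omega))
  rw [doubleSwap, mul_assoc (tNat n 1 * tNat n 0)]
  exact h1.mul_right h2

lemma evenProd_mul_doubleSwap (hn : 4 ≤ n) {k : ℕ} (hk : 2 ≤ k) (hkn : 2 * k ≤ n) :
    evenProd n k * doubleSwap n = doubleSwap n * (evenProd n k * zU n) := by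
  induction k, hk using Nat.le_induction with
  | base =>
    have h02 := tNat_mul_tNat_of_far (n := n) (i := 2) (j := 0) (by omega) (by omega) (by omega)
    have hzc := zU_mul_tNat (n := n)
    simp only [evenProd, one_mul, mul_zero, mul_one]
    rw [mul_assoc, tNat_two_mul_doubleSwap hn, ← mul_assoc, tNat_zero_mul_doubleSwap hn,
      mul_assoc, h02, ← mul_assoc (zU n), hzc, mul_assoc, hzc, mul_assoc]
  | succ k hk ih =>
    have hc := commute_tNat_doubleSwap (n := n) (j := 2 * k) (by omega) (by omega)
    simp only [evenProd]
    rw [mul_assoc, hc.eq, ← mul_assoc, ih (by omega)]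
    simp only [mul_assoc, zU_mul_tNat]

end Relations

section Lift

variable {n : ℕ} {lam : SchurCover n →* Perm (Fin n)}

lemma sign_map_tNat (ht : ∀ i : Fin (n - 1), lam (tU n i) = transpo n i) {i : ℕ}
    (hi : i < n - 1) : sign (lam (tNat n i)) = -1 := by
  rw [tNat_of_lt hi, ht, transpo]
  exact sign_swap (by simp [Fin.ext_iff])

lemma map_surjective (ht : ∀ i : Fin (n - 1), lam (tU n i) = transpo n i) :
    Function.Surjective lam := by
  cases n with
  | zero => exact fun x => ⟨1, Subsingleton.elim _ _⟩
  | succ m =>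
    rw [← MonoidHom.mrange_eq_top, eq_top_iff, ← mclosure_swap_castSucc_succ m,
      Submonoid.closure_le]
    rintro _ ⟨i, rfl⟩
    exact ⟨tU (m + 1) i, ht i⟩

lemma map_evenProd_apply (ht : ∀ i : Fin (n - 1), lam (tU n i) = transpo n i) {k : ℕ}
    (hkn : 2 * k ≤ n) (a : Fin n) (ha : 2 * k ≤ a) : lam (evenProd n k) a = a := by
  induction k with
  | zero => simp [evenProd]
  | succ k ih =>
    rw [evenProd, map_mul, tNat_of_lt (by omega), ht, transpo, Perm.mul_apply,
      swap_apply_of_ne_of_ne, ih (by omega) (by omega)] <;>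
    · simp only [ne_eq, Fin.ext_iff]; omega

lemma cycleType_map_evenProd (ht : ∀ i : Fin (n - 1), lam (tU n i) = transpo n i) {k : ℕ}
    (hkn : 2 * k ≤ n) : (lam (evenProd n k)).cycleType = Multiset.replicate k 2 := by
  induction k with
  | zero => simp [evenProd]
  | succ k ih =>
    have hne : (⟨2 * k, by omega⟩ : Fin n) ≠ ⟨2 * k + 1, by omega⟩ := by simp [Fin.ext_iff]
    have hd : Disjoint (lam (evenProd n k)) (transpo n ⟨2 * k, by omega⟩) := by
      intro a
      by_cases ha : 2 * k ≤ a
      · exact Or.inl (map_evenProd_apply ht (by omega) a ha)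
      · refine Or.inr (swap_apply_of_ne_of_ne ?_ ?_) <;>
        · simp only [ne_eq, Fin.ext_iff]; omega
    rw [evenProd, map_mul, tNat_of_lt (by omega), ht, hd.cycleType_mul, ih (by omega), transpo,
      (isCycle_swap hne).cycleType, card_support_swap hne, Multiset.replicate_succ, add_comm]
    rfl

/-- If the lifts `y`, `g` satisfy `y g = g y z` and `H` contains a conjugate of the image of `y`,
then `z` lies in the focal subgroup relative to any normal subgroup containing `g`. -/
lemma zU_mem_focalIn (hz : lam (zU n) = 1)
    (ht : ∀ i : Fin (n - 1), lam (tU n i) = transpo n i) {H : Subgroup (Perm (Fin n))}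
    {A : Subgroup (SchurCover n)} [A.Normal] {x : Perm (Fin n)} (hx : x ∈ H)
    {y g : SchurCover n} (hxy : IsConj (lam y) x) (hg : g ∈ A) (hyg : y * g = g * (y * zU n)) :
    zU n ∈ focalIn A (H.comap lam) := by
  obtain ⟨c, rfl⟩ := isConj_iff.mp hxy
  obtain ⟨s, rfl⟩ := map_surjective ht c
  have hzs : s * zU n = zU n * s := by
    have hs : s ∈ Subgroup.centralizer {zU n} := by
      suffices h : (⊤ : Subgroup (SchurCover n)) ≤ Subgroup.centralizer {zU n} from h trivial
      rw [← PresentedGroup.closure_range_of, Subgroup.closure_le]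
      rintro _ ⟨⟨⟩ | i, rfl⟩
      · exact Subgroup.mem_centralizer_singleton_iff.mpr rfl
      · exact Subgroup.mem_centralizer_singleton_iff.mpr (zU_mul_tU i).symm
    exact (Subgroup.mem_centralizer_singleton_iff.mp hs)
  have hconj : (s * g * s⁻¹)⁻¹ * (s * y * s⁻¹) * (s * g * s⁻¹) = s * y * s⁻¹ * zU n := by
    calc _ = s * g⁻¹ * (y * g) * s⁻¹ := by group
      _ = s * y * (zU n * s⁻¹) := by rw [hyg]; group
      _ = s * y * (s⁻¹ * (s * zU n) * s⁻¹) := by group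
      _ = _ := by rw [hzs]; group
  refine Subgroup.subset_closure ⟨s * y * s⁻¹, ?_, s * g * s⁻¹,
    Subgroup.Normal.conj_mem inferInstance _ hg _, ?_, ?_⟩
  · simpa using hx
  · rw [hconj]
    simpa [hz] using hx
  · rw [hconj, inv_mul_cancel_left]

lemma doubleSwap_mem_comap_alternatingGroup (hn : 4 ≤ n)
    (ht : ∀ i : Fin (n - 1), lam (tU n i) = transpo n i) :
    doubleSwap n ∈ (alternatingGroup (Fin n)).comap lam := by
  simp only [Subgroup.mem_comap, mem_alternatingGroup, doubleSwap, map_mul]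
  simp [sign_map_tNat ht (show 0 < n - 1 by omega), sign_map_tNat ht (show 1 < n - 1 by omega),
    sign_map_tNat ht (show 2 < n - 1 by omega)]

end Lift

/-- Let `n ≥ 4`, let `λ : Uₙ → Sₙ` be the homomorphism with
`λ(tᵢ) = (i, i+1)` and `λ(z) = 1`, and let `H ≤ Sₙ` have even order. Then
`z ∈ Φ^{Uₙ}(λ⁻¹(H))`; moreover, if `H ≤ Aₙ`, then `z ∈ Φ^{V}(λ⁻¹(H))` where
`V = λ⁻¹(Aₙ)`. -/
theorem z_mem_focal_of_even_order (n : ℕ) (hn : 4 ≤ n)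
    (lam : SchurCover n →* Equiv.Perm (Fin n))
    (hz : lam (zU n) = 1)
    (ht : ∀ i : Fin (n - 1), lam (tU n i) = transpo n i)
    (H : Subgroup (Equiv.Perm (Fin n))) (hH : Even (Nat.card H)) :
    zU n ∈ focalIn ⊤ (H.comap lam) ∧
    (H ≤ alternatingGroup (Fin n) →
      zU n ∈ focalIn ((alternatingGroup (Fin n)).comap lam) (H.comap lam)) := by
  have : Fact (Nat.Prime 2) := ⟨Nat.prime_two⟩
  obtain ⟨x, hx⟩ := exists_prime_orderOf_dvd_card' (G := H) 2 hH.two_dvd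
  rw [← Subgroup.orderOf_coe] at hx
  obtain ⟨k, hk⟩ := cycleType_prime_order (σ := (x : Perm (Fin n))) (by rw [hx]; exact this.out)
  rw [hx] at hk
  have hkn : 2 * (k + 1) ≤ n := by
    have h := sum_cycleType (x : Perm (Fin n))
    have h' := Finset.card_le_univ (x : Perm (Fin n)).support
    rw [hk, Multiset.sum_replicate, smul_eq_mul] at h
    rw [Fintype.card_fin] at h'
    omega
  have hconj : IsConj (lam (evenProd n (k + 1))) x := by
    rw [isConj_iff_cycleType_eq, hk, cycleType_map_evenProd ht hkn]
  rcases k with _ | k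
  · constructor
    · refine zU_mem_focalIn hz ht x.2 hconj (Subgroup.mem_top (tNat n 2)) ?_
      simp only [evenProd, one_mul, mul_zero]
      rw [tNat_mul_tNat_of_far (by omega) (by omega) (by omega), ← mul_assoc, zU_mul_tNat,
        mul_assoc, zU_mul_tNat]
    · intro hA
      have hs := mem_alternatingGroup.mp (hA x.2)
      rw [sign_of_cycleType, hk] at hs
      exact absurd hs (by decide)
  · have hrel := evenProd_mul_doubleSwap hn (k := k + 1 + 1) (by omega) hkn
    exact ⟨zU_mem_focalIn hz ht x.2 hconj (Subgroup.mem_top _) hrel, fun _ =>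
      zU_mem_focalIn hz ht x.2 hconj (doubleSwap_mem_comap_alternatingGroup hn ht) hrel⟩
end
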